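/- arXiv:1611.09525 — 4 statements merged into one kernel-verified Lean document; each statement's English description precedes it below -/
import Mathlib

section
/- The real roots of σ-polynomials of finite simple graphs are dense in the interval (-∞, 0): for every real number y ≤ 0 and every ε > 0, there exist a finite simple graph G and a real number r with σ(G, r) = 0 and |r − y| < ε. -/
/-- `sigmaCoeff G i` is the number of `i`-colour partitions of `G`, i.e. the number of
partitions of the vertex set of `G` into `i` nonempty independent sets. -/
noncomputable def sigmaCoeff {V : Type} [Fintype V] [DecidableEq V]
    (G : SimpleGraph V) (i : ℕ) : ℕ :=
  Nat.card {F : Finset (Finset V) // F.card = i ∧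
    (∀ p ∈ F, p.Nonempty) ∧
    (∀ p ∈ F, ∀ q ∈ F, p ≠ q → Disjoint p q) ∧
    F.sup id = Finset.univ ∧
    (∀ p ∈ F, ∀ u ∈ p, ∀ v ∈ p, ¬ G.Adj u v)}

/-- The σ-polynomial of `G`, evaluated at `x` : `σ(G,x) = Σ_{i=0}^{n} a_i(G) x^i`. -/
noncomputable def sigmaPoly {V : Type} [Fintype V] [DecidableEq V]
    (G : SimpleGraph V) (x : ℝ) : ℝ :=
  ∑ i ∈ Finset.range (Fintype.card V + 1), (sigmaCoeff G i : ℝ) * x ^ i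

open Polynomial in
/-- The polynomial `∑ₖ C(n,k) (n+1)(n)⋯(k+2) Xᵏ`, a rescaling of the associated Laguerre
polynomial `L_n^{(1)}(-X)`. -/
noncomputable def laguerreOne (n : ℕ) : ℝ[X] :=
  ∑ k ∈ Finset.range (n + 1), monomial k ((n.choose k * (n + 1).descFactorial (n - k) : ℕ) : ℝ)

theorem laguerreOne_coeff (n k : ℕ) :
    (laguerreOne n).coeff k = ((n.choose k * (n + 1).descFactorial (n - k) : ℕ) : ℝ) := by
  rw [laguerreOne, Polynomial.finsetSum_coeff]
  simp only [Polynomial.coeff_monomial, Finset.sum_ite_eq', Finset.mem_range]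
  split_ifs with h
  · rfl
  · rw [Nat.choose_eq_zero_of_lt (by omega)]
    simp

theorem laguerreOne_coeff_succ (n k : ℕ) :
    ((k : ℝ) + 1) * (k + 2) * (laguerreOne n).coeff (k + 1) =
      (n - k) * (laguerreOne n).coeff k := by
  simp only [laguerreOne_coeff]
  rcases lt_trichotomy k n with h | rfl | h
  · obtain ⟨m, rfl⟩ := Nat.exists_eq_add_of_lt h
    have hc := Nat.choose_succ_right_eq (k + m + 1) k
    rw [show k + m + 1 - k = m + 1 by omega] at *
    rw [show k + m + 1 - (k + 1) = m by omega, Nat.descFactorial_succ,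
      show k + m + 1 + 1 - m = k + 2 by omega]
    have hc' : ((k + m + 1).choose (k + 1) : ℝ) * (k + 1) = (k + m + 1).choose k * (m + 1) := by
      exact_mod_cast hc
    push_cast
    linear_combination ((k : ℝ) + 2) * ((k + m + 1 + 1).descFactorial m : ℝ) * hc'
  · simp
  · rw [Nat.choose_eq_zero_of_lt h, Nat.choose_eq_zero_of_lt (by omega : n < k + 1)]
    simp

open Polynomial in
theorem laguerreOne_ode (n : ℕ) :
    X * derivative (derivative (laguerreOne n)) + (2 + X) * derivative (laguerreOne n) =
      (n : ℝ[X]) * laguerreOne n := by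
  ext k
  rw [add_mul, show (2 : ℝ[X]) = C 2 from rfl, show (n : ℝ[X]) = C (n : ℝ) by simp]
  rcases k with _ | k
  · have h := laguerreOne_coeff_succ n 0
    simp only [coeff_add, mul_coeff_zero, coeff_C_zero, coeff_X_zero, coeff_derivative]
    push_cast at h ⊢
    linear_combination h
  · have h := laguerreOne_coeff_succ n (k + 1)
    simp only [coeff_add, coeff_C_mul, coeff_X_mul, coeff_derivative]
    push_cast at h ⊢
    linear_combination h

/-- Sturm comparison with `sin`, for a positive solution. -/
theorem sturm_not_pos {u u' q : ℝ → ℝ} {a b : ℝ} (hab : a < b)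
    (hu : ∀ x, HasDerivAt u (u' x) x)
    (hu' : ∀ x ∈ Set.Icc a b, HasDerivAt u' (-(q x * u x)) x)
    (hq : ∀ x ∈ Set.Icc a b, (Real.pi / (b - a)) ^ 2 ≤ q x) :
    ¬ ∀ x ∈ Set.Icc a b, 0 < u x := by
  intro hpos
  have hba : 0 < b - a := sub_pos.2 hab
  set w := Real.pi / (b - a) with hw
  have hw0 : 0 < w := div_pos Real.pi_pos hba
  have hs (x : ℝ) : HasDerivAt (fun x => Real.sin (w * (x - a)))
      (w * Real.cos (w * (x - a))) x :=
    (((hasDerivAt_id' x).sub_const a).const_mul w).sin.congr_deriv (by ring)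
  have hc (x : ℝ) : HasDerivAt (fun x => w * Real.cos (w * (x - a)))
      (-(w ^ 2 * Real.sin (w * (x - a)))) x :=
    ((((hasDerivAt_id' x).sub_const a).const_mul w).cos.const_mul w).congr_deriv (by ring)
  have hW (x : ℝ) (hx : x ∈ Set.Icc a b) := ((hu' x hx).mul (hs x)).sub ((hu x).mul (hc x))
  have hanti := antitoneOn_of_deriv_nonpos (convex_Icc a b)
    (fun x hx => (hW x hx).continuousAt.continuousWithinAt)
    (fun x hx => (hW x (interior_subset hx)).differentiableAt.differentiableWithinAt)
    (fun x hx => by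
      have hx := interior_subset hx
      rw [(hW x hx).deriv]
      have hsin : 0 ≤ Real.sin (w * (x - a)) := by
        apply Real.sin_nonneg_of_nonneg_of_le_pi
        · exact mul_nonneg hw0.le (sub_nonneg.2 hx.1)
        · calc w * (x - a) ≤ w * (b - a) := by gcongr; exact hx.2
            _ = Real.pi := by rw [hw]; field_simp
      have := mul_nonneg (mul_nonneg (sub_nonneg.2 (hq x hx)) (hpos x hx).le) hsin
      nlinarith)
  have h := hanti (Set.left_mem_Icc.2 hab.le) (Set.right_mem_Icc.2 hab.le) hab.le
  have hwb : w * (b - a) = Real.pi := by rw [hw]; field_simp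
  simp only [Pi.sub_apply, Pi.mul_apply, hwb, Real.sin_pi, Real.cos_pi, sub_self, mul_zero,
    Real.sin_zero, Real.cos_zero] at h
  have h1 := mul_pos (hpos a (Set.left_mem_Icc.2 hab.le)) hw0
  have h2 := mul_pos (hpos b (Set.right_mem_Icc.2 hab.le)) hw0
  linarith

/-- Sturm comparison with `sin`: a solution of `u'' + q u = 0` with `q ≥ (π / (b - a))²` on
`[a, b]` vanishes somewhere on `[a, b]`. -/
theorem sturm_exists_zero {u u' q : ℝ → ℝ} {a b : ℝ} (hab : a < b)
    (hu : ∀ x, HasDerivAt u (u' x) x)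
    (hu' : ∀ x ∈ Set.Icc a b, HasDerivAt u' (-(q x * u x)) x)
    (hq : ∀ x ∈ Set.Icc a b, (Real.pi / (b - a)) ^ 2 ≤ q x) :
    ∃ x ∈ Set.Icc a b, u x = 0 := by
  by_contra! hne
  have hcont : ContinuousOn u (Set.Icc a b) := fun x _ => (hu x).continuousAt.continuousWithinAt
  have hsign (x : ℝ) (hx : x ∈ Set.Icc a b) (z : ℝ) (hz : z ∈ Set.Icc a b)
      (hx0 : u x ≤ 0) (hz0 : 0 ≤ u z) : False := by
    obtain ⟨c, hc, hc0⟩ := isPreconnected_Icc.intermediate_value hx hz hcont ⟨hx0, hz0⟩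
    exact hne c hc hc0
  have ha := Set.left_mem_Icc.2 hab.le
  rcases le_total 0 (u a) with h0 | h0
  · exact sturm_not_pos hab hu hu' hq fun x hx => not_le.1 fun h => hsign x hx a ha h h0
  · refine sturm_not_pos (u := fun x => -u x) (u' := fun x => -u' x) hab (fun x => (hu x).neg)
      (fun x hx => (hu' x hx).neg.congr_deriv (by ring)) hq fun x hx => ?_
    exact neg_pos.2 (not_le.1 fun h => hsign a ha x hx h0 h)

theorem laguerreOne_exists_zero {a b : ℝ} (hab : a < b) (hb : b < 0) :
    ∃ n : ℕ, ∃ r ∈ Set.Icc a b, (laguerreOne n).eval r = 0 := by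
  obtain ⟨n, hn⟩ := exists_nat_ge (((Real.pi / (b - a)) ^ 2 + 1 / 4) * -a)
  refine ⟨n, ?_⟩
  set P := laguerreOne n with hP
  have hE (x : ℝ) : HasDerivAt (fun x : ℝ => Real.exp (x / 2)) (Real.exp (x / 2) * (1 / 2)) x :=
    ((hasDerivAt_id x).div_const 2).exp
  have hode (x : ℝ) : x * P.derivative.derivative.eval x + (2 + x) * P.derivative.eval x =
      n * P.eval x := by
    simpa using congrArg (Polynomial.eval x) (laguerreOne_ode n)
  obtain ⟨r, hr, h0⟩ := sturm_exists_zero (a := a) (b := b)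
    (u := fun x => Real.exp (x / 2) * (x * P.eval x))
    (u' := fun x => Real.exp (x / 2) *
      (P.eval x + x * P.derivative.eval x + x * P.eval x * (1 / 2)))
    (q := fun x => -(1 / 4 + (n + 1) / x)) hab
    (fun x => ((hE x).fun_mul ((hasDerivAt_id' x).fun_mul (P.hasDerivAt x))).congr_deriv (by ring))
    (fun x hx => by
      have hx0 : x ≠ 0 := (hx.2.trans_lt hb).ne
      refine ((hE x).fun_mul (((P.hasDerivAt x).fun_add
        ((hasDerivAt_id' x).fun_mul (P.derivative.hasDerivAt x))).fun_add
        (((hasDerivAt_id' x).fun_mul (P.hasDerivAt x)).mul_const (1 / 2)))).congr_deriv ?_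
      field_simp
      linear_combination 16 * hode x)
    (fun x hx => by
      have hx0 : x < 0 := hx.2.trans_lt hb
      have h : (Real.pi / (b - a)) ^ 2 + 1 / 4 ≤ (n + 1) / (-x) := by
        rw [le_div_iff₀ (neg_pos.2 hx0)]
        have : ((Real.pi / (b - a)) ^ 2 + 1 / 4) * -x ≤
            ((Real.pi / (b - a)) ^ 2 + 1 / 4) * -a := by
          gcongr
          exact hx.1
        linarith
      rw [div_neg] at h
      linarith)
  refine ⟨r, hr, ?_⟩
  simpa [(hr.2.trans_lt hb).ne] using h0

/-- `F` is a partition of the vertices of `G` into nonempty independent sets. -/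
def IsColourPartition {V : Type} [Fintype V] [DecidableEq V] (G : SimpleGraph V)
    (F : Finset (Finset V)) : Prop :=
  (∀ p ∈ F, p.Nonempty) ∧
    (∀ p ∈ F, ∀ q ∈ F, p ≠ q → Disjoint p q) ∧
    F.sup id = Finset.univ ∧
    (∀ p ∈ F, ∀ u ∈ p, ∀ v ∈ p, ¬ G.Adj u v)

theorem sigmaCoeff_eq {V : Type} [Fintype V] [DecidableEq V] (G : SimpleGraph V) (i : ℕ) :
    sigmaCoeff G i = Nat.card {F : Finset (Finset V) // F.card = i ∧ IsColourPartition G F} :=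
  rfl

theorem IsColourPartition.map {V W : Type} [Fintype V] [DecidableEq V] [Fintype W]
    [DecidableEq W] {G : SimpleGraph V} {H : SimpleGraph W} (e : G ≃g H)
    {F : Finset (Finset V)} (hF : IsColourPartition G F) :
    IsColourPartition H (e.toEquiv.finsetCongr.finsetCongr F) := by
  obtain ⟨h1, h2, h3, h4⟩ := hF
  simp only [IsColourPartition, Equiv.finsetCongr_apply, Finset.mem_map, Equiv.coe_toEmbedding,
    forall_exists_index, and_imp, forall_apply_eq_imp_iff₂, Finset.map_nonempty,
    Finset.disjoint_map]
  refine ⟨h1, fun p hp q hq hpq => h2 p hp q hq fun h => hpq (h ▸ rfl), ?_, ?_⟩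
  · ext w
    have hw : e.symm w ∈ F.sup id := h3 ▸ Finset.mem_univ _
    simp only [Finset.mem_sup, id] at hw
    obtain ⟨p, hp, hwp⟩ := hw
    simp only [Finset.mem_sup, Finset.mem_map, Finset.mem_univ, iff_true, id]
    refine ⟨_, ⟨p, hp, rfl⟩, ?_⟩
    simp only [Equiv.coe_toEmbedding, Equiv.finsetCongr_apply, Finset.mem_map]
    exact ⟨_, hwp, e.apply_symm_apply w⟩
  · intro p hp u hu v hv hadj
    exact h4 p hp u hu v hv (e.map_adj_iff.1 hadj)

theorem sigmaCoeff_congr {V W : Type} [Fintype V] [DecidableEq V] [Fintype W]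
    [DecidableEq W] {G : SimpleGraph V} {H : SimpleGraph W} (e : G ≃g H) (i : ℕ) :
    sigmaCoeff G i = sigmaCoeff H i := by
  rw [sigmaCoeff_eq, sigmaCoeff_eq]
  refine Nat.card_congr (e.toEquiv.finsetCongr.finsetCongr.subtypeEquiv fun F => ?_)
  refine and_congr (by simp) ⟨fun h => h.map e, fun h => ?_⟩
  convert h.map e.symm
  exact (e.toEquiv.finsetCongr.finsetCongr.symm_apply_apply F).symm

theorem IsColourPartition.exists_mem {V : Type} [Fintype V] [DecidableEq V] {G : SimpleGraph V}
    {F : Finset (Finset V)} (hF : IsColourPartition G F) (v : V) : ∃ p ∈ F, v ∈ p := by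
  have hv : v ∈ F.sup id := hF.2.2.1 ▸ Finset.mem_univ v
  simpa using hv

theorem IsColourPartition.eq_of_mem {V : Type} [Fintype V] [DecidableEq V] {G : SimpleGraph V}
    {F : Finset (Finset V)} (hF : IsColourPartition G F) {p q : Finset V} (hp : p ∈ F)
    (hq : q ∈ F) {v : V} (hvp : v ∈ p) (hvq : v ∈ q) : p = q :=
  by_contra fun h => Finset.disjoint_left.1 (hF.2.1 p hp q hq h) hvp hvq

theorem IsColourPartition.eq_of_subset {V : Type} [Fintype V] [DecidableEq V]
    {G : SimpleGraph V} {F F' : Finset (Finset V)} (hF : IsColourPartition G F)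
    (hF' : IsColourPartition G F') (h : F ⊆ F') : F = F' := by
  refine h.antisymm fun q hq => ?_
  obtain ⟨v, hv⟩ := hF'.1 q hq
  obtain ⟨p, hp, hvp⟩ := hF.exists_mem v
  exact hF'.eq_of_mem hq (h hp) hv hvp ▸ hp

section TwoCliques

variable {A B : Type} [Fintype A] [Fintype B]

open Classical in
/-- The colour class of `b : B` when the vertices of `A` outside `U` are matched into `B`
by `f`. -/
noncomputable def matchingClass (U : Finset A) (f : {a // a ∉ U} ↪ B) (b : B) :
    Finset (A ⊕ B) :=
  Finset.univ.filter (Sum.elim (fun a => ∃ h : a ∉ U, f ⟨a, h⟩ = b) (· = b))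

theorem inl_mem_matchingClass {U : Finset A} {f : {a // a ∉ U} ↪ B} {a : A} {b : B} :
    Sum.inl a ∈ matchingClass U f b ↔ ∃ h : a ∉ U, f ⟨a, h⟩ = b := by
  simp [matchingClass]

theorem inr_mem_matchingClass {U : Finset A} {f : {a // a ∉ U} ↪ B} {b b' : B} :
    Sum.inr b' ∈ matchingClass U f b ↔ b' = b := by
  simp [matchingClass]

variable [DecidableEq A] [DecidableEq B]

/-- The colour partition of a disjoint union of two cliques given by a matching `f`
of the vertices of `A` outside `U` into `B`. -/
noncomputable def matchingPartition (U : Finset A) (f : {a // a ∉ U} ↪ B) :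
    Finset (Finset (A ⊕ B)) :=
  U.image (fun a => {Sum.inl a}) ∪ Finset.univ.image (matchingClass U f)

theorem mem_matchingPartition {U : Finset A} {f : {a // a ∉ U} ↪ B} {p : Finset (A ⊕ B)} :
    p ∈ matchingPartition U f ↔ (∃ a ∈ U, {Sum.inl a} = p) ∨ ∃ b, matchingClass U f b = p := by
  simp [matchingPartition]

theorem card_matchingPartition (U : Finset A) (f : {a // a ∉ U} ↪ B) :
    (matchingPartition U f).card = U.card + Fintype.card B := by
  rw [matchingPartition, Finset.card_union_of_disjoint, Finset.card_image_of_injective,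
    Finset.card_image_of_injective, Finset.card_univ]
  · intro b b' h
    exact inr_mem_matchingClass.1 (h ▸ inr_mem_matchingClass.2 rfl : _ ∈ matchingClass U f b')
  · intro a a' h
    simpa using h
  · simp only [Finset.disjoint_left, Finset.mem_image, Finset.mem_univ, true_and, not_exists]
    rintro _ ⟨a, -, rfl⟩ b h
    have := h ▸ (inr_mem_matchingClass (f := f)).2 (rfl : b = b)
    simp at this

theorem isColourPartition_matchingPartition (U : Finset A) (f : {a // a ∉ U} ↪ B) :
    IsColourPartition ((⊤ : SimpleGraph A) ⊕g (⊤ : SimpleGraph B)) (matchingPartition U f) := by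
  refine ⟨?_, ?_, ?_, ?_⟩
  · simp only [mem_matchingPartition]
    rintro p (⟨a, -, rfl⟩ | ⟨b, rfl⟩)
    · simp
    · exact ⟨_, inr_mem_matchingClass.2 rfl⟩
  · simp only [mem_matchingPartition]
    rintro p (⟨a, ha, rfl⟩ | ⟨b, rfl⟩) q (⟨a', ha', rfl⟩ | ⟨b', rfl⟩) hpq
    · simpa using hpq
    · simp [inl_mem_matchingClass, ha]
    · simp [inl_mem_matchingClass, ha']
    · rw [Finset.disjoint_left]
      rintro (a | c) h h'
      · obtain ⟨_, rfl⟩ := inl_mem_matchingClass.1 h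
        obtain ⟨_, rfl⟩ := inl_mem_matchingClass.1 h'
        exact hpq rfl
      · exact hpq (by rw [← inr_mem_matchingClass.1 h, ← inr_mem_matchingClass.1 h'])
  · ext v
    simp only [Finset.mem_sup, mem_matchingPartition, id, Finset.mem_univ, iff_true]
    rcases v with a | b
    · by_cases ha : a ∈ U
      · exact ⟨_, Or.inl ⟨a, ha, rfl⟩, by simp⟩
      · exact ⟨_, Or.inr ⟨f ⟨a, ha⟩, rfl⟩, inl_mem_matchingClass.2 ⟨ha, rfl⟩⟩
    · exact ⟨_, Or.inr ⟨b, rfl⟩, inr_mem_matchingClass.2 rfl⟩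
  · simp only [mem_matchingPartition]
    rintro p (⟨a, -, rfl⟩ | ⟨b, rfl⟩)
    · simp
    · rintro (a | c) hu (a' | c') hv
      · obtain ⟨h, hf⟩ := inl_mem_matchingClass.1 hu
        obtain ⟨h', hf'⟩ := inl_mem_matchingClass.1 hv
        simpa using f.injective (hf.trans hf'.symm)
      · simp
      · simp
      · simp [inr_mem_matchingClass.1 hu, inr_mem_matchingClass.1 hv]

theorem matchingPartition_mem_pair {U : Finset A} {f : {a // a ∉ U} ↪ B} {a : A} {b : B} :
    (∃ p ∈ matchingPartition U f, Sum.inl a ∈ p ∧ Sum.inr b ∈ p) ↔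
      ∃ h : a ∉ U, f ⟨a, h⟩ = b := by
  simp only [mem_matchingPartition]
  constructor
  · rintro ⟨p, ⟨a', -, rfl⟩ | ⟨b', rfl⟩, ha, hb⟩
    · simp at hb
    · rw [inr_mem_matchingClass.1 hb]
      exact inl_mem_matchingClass.1 ha
  · intro h
    exact ⟨_, Or.inr ⟨b, rfl⟩, inl_mem_matchingClass.2 h, inr_mem_matchingClass.2 rfl⟩

theorem matchingPartition_injective :
    Function.Injective (fun x : Σ U : Finset A, ({a // a ∉ U} ↪ B) =>
      matchingPartition x.1 x.2) := by
  rintro ⟨U, f⟩ ⟨U', f'⟩ h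
  have key (a : A) (b : B) : (∃ h : a ∉ U, f ⟨a, h⟩ = b) ↔ ∃ h : a ∉ U', f' ⟨a, h⟩ = b := by
    rw [← matchingPartition_mem_pair, ← matchingPartition_mem_pair]
    simp only at h
    rw [h]
  obtain rfl : U = U' := by
    ext a
    rw [← not_iff_not]
    exact ⟨fun ha => ((key a _).1 ⟨ha, rfl⟩).1, fun ha => ((key a _).2 ⟨ha, rfl⟩).1⟩
  obtain rfl : f = f' := by
    ext ⟨a, ha⟩
    obtain ⟨_, h⟩ := (key a _).1 ⟨ha, rfl⟩
    exact h.symm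
  rfl

theorem exists_matchingPartition_eq {F : Finset (Finset (A ⊕ B))}
    (hF : IsColourPartition ((⊤ : SimpleGraph A) ⊕g (⊤ : SimpleGraph B)) F) :
    ∃ (U : Finset A) (f : {a // a ∉ U} ↪ B), matchingPartition U f = F := by
  classical
  have hA {p : Finset (A ⊕ B)} (hp : p ∈ F) {a a' : A} (h : Sum.inl a ∈ p)
      (h' : Sum.inl a' ∈ p) : a = a' := by
    simpa using hF.2.2.2 p hp _ h _ h'
  have hB {p : Finset (A ⊕ B)} (hp : p ∈ F) {b b' : B} (h : Sum.inr b ∈ p)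
      (h' : Sum.inr b' ∈ p) : b = b' := by
    simpa using hF.2.2.2 p hp _ h _ h'
  let U : Finset A := Finset.univ.filter fun a => ¬ ∃ b, ∃ p ∈ F, Sum.inl a ∈ p ∧ Sum.inr b ∈ p
  have hU (a : {a // a ∉ U}) : ∃ b, ∃ p ∈ F, Sum.inl a.1 ∈ p ∧ Sum.inr b ∈ p := by
    have := a.2
    simpa only [U, Finset.mem_filter, Finset.mem_univ, true_and, not_not] using this
  choose g hg using hU
  have hinj : Function.Injective g := by
    intro a a' h
    obtain ⟨p, hp, hap, hbp⟩ := hg a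
    obtain ⟨q, hq, haq, hbq⟩ := hg a'
    obtain rfl := hF.eq_of_mem hp hq hbp (h ▸ hbq)
    exact Subtype.ext (hA hp hap haq)
  refine ⟨U, ⟨g, hinj⟩, (isColourPartition_matchingPartition U _).eq_of_subset hF ?_⟩
  intro p hp
  rcases mem_matchingPartition.1 hp with ⟨a, ha, rfl⟩ | ⟨b, rfl⟩
  · obtain ⟨q, hq, haq⟩ := hF.exists_mem (Sum.inl a)
    convert hq
    ext (a' | b')
    · simp only [Finset.mem_singleton, Sum.inl.injEq]
      exact ⟨fun h => h ▸ haq, fun h => hA hq h haq⟩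
    · simp only [Finset.mem_singleton, reduceCtorEq, false_iff]
      intro hb
      exact (Finset.mem_filter.1 ha).2 ⟨b', q, hq, haq, hb⟩
  · obtain ⟨q, hq, hbq⟩ := hF.exists_mem (Sum.inr b)
    convert hq
    ext (a' | b')
    · rw [inl_mem_matchingClass]
      constructor
      · rintro ⟨h, rfl⟩
        obtain ⟨p, hp, hap, hbp⟩ := hg ⟨a', h⟩
        exact hF.eq_of_mem hp hq hbp hbq ▸ hap
      · intro haq
        have h : a' ∉ U := fun h => (Finset.mem_filter.1 h).2 ⟨b, q, hq, haq, hbq⟩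
        obtain ⟨p, hp, hap, hbp⟩ := hg ⟨a', h⟩
        exact ⟨h, hB hq (hF.eq_of_mem hp hq hap haq ▸ hbp) hbq⟩
    · rw [inr_mem_matchingClass]
      exact ⟨fun h => h ▸ hbq, fun h => hB hq h hbq⟩

theorem sigmaCoeff_top_sum_top (i : ℕ) :
    sigmaCoeff ((⊤ : SimpleGraph A) ⊕g (⊤ : SimpleGraph B)) i =
      ∑ U : Finset A, if U.card + Fintype.card B = i then
        (Fintype.card B).descFactorial (Fintype.card A - U.card) else 0 := by
  have e : {x : Σ U : Finset A, ({a // a ∉ U} ↪ B) // x.1.card + Fintype.card B = i} ≃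
      {F : Finset (Finset (A ⊕ B)) // F.card = i ∧
        IsColourPartition ((⊤ : SimpleGraph A) ⊕g (⊤ : SimpleGraph B)) F} := by
    refine Equiv.ofBijective (fun x => ⟨matchingPartition x.1.1 x.1.2,
      (card_matchingPartition _ _).trans x.2, isColourPartition_matchingPartition _ _⟩)
      ⟨fun x y h => Subtype.ext (matchingPartition_injective (congrArg Subtype.val h)), ?_⟩
    rintro ⟨F, hFi, hF⟩
    obtain ⟨U, f, rfl⟩ := exists_matchingPartition_eq hF
    exact ⟨⟨⟨U, f⟩, (card_matchingPartition U f).symm.trans hFi⟩, rfl⟩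
  rw [sigmaCoeff_eq, ← Nat.card_congr e, Nat.card_eq_fintype_card, Fintype.card_subtype,
    Finset.card_filter, Fintype.sum_sigma]
  refine Finset.sum_congr rfl fun U _ => ?_
  split_ifs with h
  · simp [Fintype.card_embedding_eq, Fintype.card_subtype_compl]
  · simp

theorem sigmaPoly_top_sum_top (x : ℝ) :
    sigmaPoly ((⊤ : SimpleGraph A) ⊕g (⊤ : SimpleGraph B)) x =
      ∑ k ∈ Finset.range (Fintype.card A + 1), (((Fintype.card A).choose k *
        (Fintype.card B).descFactorial (Fintype.card A - k) : ℕ) : ℝ) *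
          x ^ (k + Fintype.card B) := by
  have hU (U : Finset A) : U.card + Fintype.card B ∈
      Finset.range (Fintype.card (A ⊕ B) + 1) := by
    have := Finset.card_le_univ U
    simp only [Fintype.card_sum, Finset.mem_range]
    omega
  simp only [sigmaPoly, sigmaCoeff_top_sum_top, Nat.cast_sum, Nat.cast_ite, Nat.cast_zero,
    Finset.sum_mul, ite_mul, zero_mul]
  rw [Finset.sum_comm]
  simp only [Finset.sum_ite_eq, hU, if_true]
  rw [← Finset.powerset_univ, Finset.sum_powerset_apply_card (fun k =>
    ((Fintype.card B).descFactorial (Fintype.card A - k) : ℝ) * x ^ (k + Fintype.card B))]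
  simp [mul_assoc]

end TwoCliques

theorem sigmaPoly_congr {V W : Type} [Fintype V] [DecidableEq V] [Fintype W]
    [DecidableEq W] {G : SimpleGraph V} {H : SimpleGraph W} (e : G ≃g H) (x : ℝ) :
    sigmaPoly G x = sigmaPoly H x := by
  simp only [sigmaPoly, sigmaCoeff_congr e, Fintype.card_congr e.toEquiv]

theorem sigmaPoly_top_sum_top_eq_laguerreOne (n : ℕ) (x : ℝ) :
    sigmaPoly ((⊤ : SimpleGraph (Fin n)) ⊕g (⊤ : SimpleGraph (Fin (n + 1)))) x =
      x ^ (n + 1) * (laguerreOne n).eval x := by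
  rw [sigmaPoly_top_sum_top, laguerreOne, Polynomial.eval_finsetSum, Finset.mul_sum]
  simp only [Fintype.card_fin, Polynomial.eval_monomial]
  refine Finset.sum_congr rfl fun k _ => ?_
  ring

/-- The real roots of σ-polynomials of finite simple graphs are dense in `(-∞, 0)`:
for every real `y ≤ 0` and `ε > 0` there are a finite simple graph `G` and a real `r`
with `σ(G, r) = 0` and `|r − y| < ε`. -/
theorem sigma_roots_dense_in_nonpos_reals :
    ∀ y : ℝ, y ≤ 0 → ∀ ε : ℝ, 0 < ε →
      ∃ (n : ℕ) (G : SimpleGraph (Fin n)) (r : ℝ),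
        sigmaPoly G r = 0 ∧ |r - y| < ε := by
  intro y hy ε hε
  obtain ⟨n, r, ⟨hr1, hr2⟩, hr⟩ :=
    laguerreOne_exists_zero (a := y - ε / 2) (b := y - ε / 4) (by linarith) (by linarith)
  let H := (⊤ : SimpleGraph (Fin n)) ⊕g (⊤ : SimpleGraph (Fin (n + 1)))
  refine ⟨n + (n + 1), H.comap finSumFinEquiv.symm, r, ?_, ?_⟩
  · rw [sigmaPoly_congr (SimpleGraph.Iso.comap finSumFinEquiv.symm H),
      sigmaPoly_top_sum_top_eq_laguerreOne, hr, mul_zero]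
  · rw [abs_lt]
    constructor <;> linarith
end

section
/- The closure in ℝ of the set of all real roots of σ-polynomials of finite simple graphs (with at least one vertex) is exactly the interval (-∞, 0]. In particular, σ(G, x) > 0 for every real x > 0 and every graph G with at least one vertex, so no σ-polynomial has a positive real root. -/
open Finset

/-- `IsIndepPartition G S F` says that `F` is a partition of `S` into nonempty independent
sets of `G`. -/
def IsIndepPartition {V : Type} [DecidableEq V] (G : SimpleGraph V) (S : Finset V)
    (F : Finset (Finset V)) : Prop :=
  (∀ p ∈ F, p.Nonempty) ∧ (∀ p ∈ F, ∀ q ∈ F, p ≠ q → Disjoint p q) ∧ F.sup id = S ∧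
    (∀ p ∈ F, ∀ u ∈ p, ∀ v ∈ p, ¬ G.Adj u v)

open Classical in
/-- The value at `x` of the σ-polynomial of the subgraph of `G` induced on `S`. -/
noncomputable def sigmaOn {V : Type} [Fintype V] [DecidableEq V] (G : SimpleGraph V)
    (S : Finset V) (x : ℝ) : ℝ :=
  ∑ F : Finset (Finset V) with IsIndepPartition G S F, x ^ F.card

section General

variable {V : Type} [DecidableEq V] {G : SimpleGraph V} {S : Finset V}
  {F : Finset (Finset V)}

theorem IsIndepPartition.subset (h : IsIndepPartition G S F) {p : Finset V} (hp : p ∈ F) :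
    p ⊆ S := by
  rw [← h.2.2.1]
  exact Finset.le_sup (f := id) hp

theorem IsIndepPartition.exists_mem (h : IsIndepPartition G S F) {v : V} (hv : v ∈ S) :
    ∃ p ∈ F, v ∈ p := by
  rw [← h.2.2.1, Finset.mem_sup] at hv
  exact hv

theorem IsIndepPartition.card_le (h : IsIndepPartition G S F) : F.card ≤ S.card := by
  have hd : (F : Set (Finset V)).PairwiseDisjoint id := fun p hp q hq hpq => h.2.1 p hp q hq hpq
  calc F.card = ∑ _p ∈ F, 1 := by simp
    _ ≤ ∑ p ∈ F, p.card := Finset.sum_le_sum fun p hp => (h.1 p hp).card_pos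
    _ = (F.biUnion id).card := (Finset.card_biUnion hd).symm
    _ ≤ S.card := Finset.card_le_card (Finset.biUnion_subset.2 fun p hp => h.subset hp)

theorem IsIndepPartition.erase (h : IsIndepPartition G S F) {C : Finset V} (hC : C ∈ F) :
    IsIndepPartition G (S \ C) (F.erase C) := by
  refine ⟨fun p hp => h.1 p (mem_of_mem_erase hp),
    fun p hp q hq => h.2.1 p (mem_of_mem_erase hp) q (mem_of_mem_erase hq), ?_,
    fun p hp => h.2.2.2 p (mem_of_mem_erase hp)⟩
  ext v
  rw [Finset.mem_sup, Finset.mem_sdiff]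
  constructor
  · rintro ⟨p, hp, hv⟩
    exact ⟨h.subset (mem_of_mem_erase hp) hv, Finset.disjoint_left.1
      (h.2.1 p (mem_of_mem_erase hp) C hC (ne_of_mem_erase hp)) hv⟩
  · rintro ⟨hv, hvC⟩
    obtain ⟨p, hp, hvp⟩ := h.exists_mem hv
    exact ⟨p, mem_erase.2 ⟨fun e => hvC (e ▸ hvp), hp⟩, hvp⟩

theorem IsIndepPartition.insert {C : Finset V} (h : IsIndepPartition G (S \ C) F)
    (hCS : C ⊆ S) (hne : C.Nonempty) (hC : ∀ u ∈ C, ∀ v ∈ C, ¬ G.Adj u v) :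
    IsIndepPartition G S (insert C F) := by
  have hdis : ∀ p ∈ F, Disjoint p C := fun p hp =>
    Finset.disjoint_of_subset_left (h.subset hp) Finset.sdiff_disjoint
  refine ⟨?_, ?_, ?_, ?_⟩
  · intro p hp
    rcases mem_insert.1 hp with rfl | hp
    exacts [hne, h.1 p hp]
  · intro p hp q hq hpq
    rcases mem_insert.1 hp with hp | hp <;> rcases mem_insert.1 hq with hq | hq
    · exact absurd (hp.trans hq.symm) hpq
    · exact hp ▸ (hdis q hq).symm
    · exact hq ▸ hdis p hp
    · exact h.2.1 p hp q hq hpq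
  · rw [Finset.sup_insert, h.2.2.1]
    exact Finset.union_sdiff_of_subset hCS
  · intro p hp
    rcases mem_insert.1 hp with rfl | hp
    exacts [hC, h.2.2.2 p hp]

theorem IsIndepPartition.notMem_of_sdiff {C : Finset V} (h : IsIndepPartition G (S \ C) F)
    (hne : C.Nonempty) : C ∉ F := by
  intro hC
  obtain ⟨v, hv⟩ := hne
  exact (Finset.mem_sdiff.1 (h.subset hC hv)).2 hv

theorem isIndepPartition_singletons (G : SimpleGraph V) (S : Finset V) :
    IsIndepPartition G S (S.image fun v => {v}) := by
  refine ⟨?_, ?_, ?_, ?_⟩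
  · simp
  · simp +contextual [eq_comm]
  · ext v
    simp
  · simp

variable [Fintype V]

theorem sigmaPoly_eq_sigmaOn (G : SimpleGraph V) (x : ℝ) :
    sigmaPoly G x = sigmaOn G univ x := by
  classical
  have hmaps : ∀ F ∈ ({F | IsIndepPartition G univ F} : Finset (Finset (Finset V))),
      F.card ∈ Finset.range (Fintype.card V + 1) := fun F hF => by
    simpa [Nat.lt_succ_iff] using (mem_filter.1 hF).2.card_le
  rw [sigmaPoly, sigmaOn, ← Finset.sum_fiberwise_of_maps_to hmaps]
  refine Finset.sum_congr rfl fun i _ => ?_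
  have hc : sigmaCoeff G i =
      #{F ∈ ({F | IsIndepPartition G univ F} : Finset (Finset (Finset V))) | F.card = i} := by
    rw [sigmaCoeff, Nat.card_eq_fintype_card, Fintype.card_subtype, Finset.filter_filter]
    refine congrArg Finset.card (Finset.filter_congr fun F _ => ?_)
    exact and_comm
  rw [hc, Finset.sum_congr rfl fun F hF => by rw [(mem_filter.1 hF).2], Finset.sum_const,
    nsmul_eq_mul]

theorem sigmaOn_pos (G : SimpleGraph V) (S : Finset V) {x : ℝ} (hx : 0 < x) :
    0 < sigmaOn G S x := by
  classical
  exact Finset.sum_pos (fun F _ => pow_pos hx _)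
    ⟨_, mem_filter.2 ⟨mem_univ _, isIndepPartition_singletons G S⟩⟩

/-- Splitting off the block of a vertex `w`. -/
theorem sigmaOn_eq_sum (G : SimpleGraph V) {w : V} (hw : w ∈ S) (x : ℝ)
    {T : Finset (Finset V)}
    (hT : ∀ C, C ∈ T ↔ C ⊆ S ∧ w ∈ C ∧ ∀ u ∈ C, ∀ v ∈ C, ¬ G.Adj u v) :
    sigmaOn G S x = ∑ C ∈ T, x * sigmaOn G (S \ C) x := by
  classical
  simp only [sigmaOn, Finset.mul_sum, Finset.sum_sigma']
  symm
  refine Finset.sum_bij (fun a _ => insert a.1 a.2) ?_ ?_ ?_ ?_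
  · rintro ⟨C, F⟩ h
    simp only [mem_sigma, hT, mem_filter, mem_univ, true_and] at h ⊢
    exact h.2.insert h.1.1 ⟨w, h.1.2.1⟩ h.1.2.2
  · rintro ⟨C, F⟩ h ⟨C', F'⟩ h' he
    simp only [mem_sigma, hT, mem_filter, mem_univ, true_and] at h h' he
    have hF := h.2.insert h.1.1 ⟨w, h.1.2.1⟩ h.1.2.2
    have hCC : C = C' := by
      by_contra hne
      exact Finset.disjoint_left.1 (hF.2.1 C (mem_insert_self _ _) C'
        (he ▸ mem_insert_self _ _) hne) h.1.2.1 h'.1.2.1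
    subst hCC
    have h1 := h.2.notMem_of_sdiff ⟨w, h.1.2.1⟩
    have h2 := h'.2.notMem_of_sdiff ⟨w, h.1.2.1⟩
    rw [← Finset.erase_insert h1, he, Finset.erase_insert h2]
  · intro F hF
    have h := (mem_filter.1 hF).2
    obtain ⟨C, hC, hwC⟩ := h.exists_mem hw
    refine ⟨⟨C, F.erase C⟩, ?_, Finset.insert_erase hC⟩
    simp only [mem_sigma, hT, mem_filter, mem_univ, true_and]
    exact ⟨⟨h.subset hC, hwC, h.2.2.2 C hC⟩, h.erase hC⟩
  · rintro ⟨C, F⟩ h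
    simp only [mem_sigma, hT, mem_filter, mem_univ, true_and] at h ⊢
    rw [Finset.card_insert_of_notMem (h.2.notMem_of_sdiff ⟨w, h.1.2.1⟩), pow_succ']

/-- In a graph whose complement is triangle-free, every block of a colour partition has at most
two elements, and the block of `w` is removed. -/
theorem sigmaOn_recursion [DecidableRel G.Adj] (hG : Gᶜ.CliqueFree 3) {w : V} (hw : w ∈ S)
    (x : ℝ) : sigmaOn G S x = x * (sigmaOn G (S.erase w) x +
      ∑ u ∈ S with Gᶜ.Adj w u, sigmaOn G ((S.erase w).erase u) x) := by
  classical
  have hblocks : ∀ C, C ∈ insert {w} (({u ∈ S | Gᶜ.Adj w u}).image fun u => {w, u}) ↔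
      C ⊆ S ∧ w ∈ C ∧ ∀ u ∈ C, ∀ v ∈ C, ¬ G.Adj u v := by
    intro C
    simp only [mem_filter, mem_insert, mem_image]
    refine Iff.symm ⟨?_, ?_⟩
    · rintro ⟨hCS, hwC, hC⟩
      by_cases h1 : C = {w}
      · exact Or.inl h1
      right
      obtain ⟨u, huC, huw⟩ : ∃ u ∈ C, u ≠ w := by
        by_contra! hcon
        exact h1 (Finset.eq_singleton_iff_unique_mem.2 ⟨hwC, hcon⟩)
      refine ⟨u, ⟨hCS huC, (G.compl_adj w u).2 ⟨huw.symm, hC w hwC u huC⟩⟩, ?_⟩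
      refine Finset.Subset.antisymm (by simp [Finset.insert_subset_iff, hwC, huC]) ?_
      intro v hv
      by_contra hvn
      simp only [mem_insert, mem_singleton, not_or] at hvn
      refine hG {w, u, v} (SimpleGraph.is3Clique_triple_iff.2 ?_)
      simp only [SimpleGraph.compl_adj]
      exact ⟨⟨huw.symm, hC w hwC u huC⟩, ⟨Ne.symm hvn.1, hC w hwC v hv⟩,
        ⟨Ne.symm hvn.2, hC u huC v hv⟩⟩
    · rintro (rfl | ⟨u, ⟨huS, hu⟩, rfl⟩)
      · simp [hw]
      · rw [SimpleGraph.compl_adj] at hu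
        simp [Finset.insert_subset_iff, hw, huS, hu.2, G.adj_comm u w]
  have hnot : ({w} : Finset V) ∉ ({u ∈ S | Gᶜ.Adj w u}).image fun u => {w, u} := by
    simp only [mem_image, mem_filter, not_exists, not_and]
    rintro u ⟨-, hu⟩ he
    have : u ∈ ({w} : Finset V) := he ▸ by simp
    exact hu.ne (mem_singleton.1 this).symm
  have hinj : Set.InjOn (fun u => ({w, u} : Finset V)) ({u ∈ S | Gᶜ.Adj w u} : Finset V) := by
    intro u hu v hv he
    have hu' := (mem_filter.1 (mem_coe.1 hu)).2.ne
    have : u ∈ ({w, v} : Finset V) := by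
      have he' : ({w, u} : Finset V) = {w, v} := he
      rw [← he']; simp
    simp only [mem_insert, mem_singleton] at this
    exact this.resolve_left hu'.symm
  rw [sigmaOn_eq_sum G hw x hblocks, Finset.sum_insert hnot, Finset.sum_image hinj, mul_add,
    Finset.mul_sum, Finset.sdiff_singleton_eq_erase]
  congr 1
  refine Finset.sum_congr rfl fun u _ => ?_
  congr 2
  ext v
  simp only [mem_sdiff, mem_insert, mem_singleton, mem_erase]
  tauto

theorem sigmaOn_empty (G : SimpleGraph V) (x : ℝ) : sigmaOn G ∅ x = 1 := by
  classical
  have : ({F | IsIndepPartition G ∅ F} : Finset (Finset (Finset V))) = {∅} := by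
    ext F
    simp only [mem_filter, mem_univ, true_and, mem_singleton]
    refine ⟨fun h => Finset.card_eq_zero.1 (Nat.le_zero.1 h.card_le), ?_⟩
    rintro rfl
    simpa using isIndepPartition_singletons G (∅ : Finset V)
  simp [sigmaOn, this]

theorem sigmaOn_of_forall_not_compl_adj (hG : Gᶜ.CliqueFree 3)
    (hS : ∀ u ∈ S, ∀ v ∈ S, ¬ Gᶜ.Adj u v) (x : ℝ) : sigmaOn G S x = x ^ S.card := by
  classical
  induction S using Finset.induction_on with
  | empty => simp [sigmaOn_empty]
  | insert w S hw ih =>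
    rw [sigmaOn_recursion hG (mem_insert_self w S), Finset.erase_insert hw,
      ih fun u hu v hv => hS u (mem_insert_of_mem hu) v (mem_insert_of_mem hv),
      Finset.filter_false_of_mem fun u hu => hS w (mem_insert_self w S) u hu,
      Finset.card_insert_of_notMem hw]
    simp [pow_succ']

theorem sigmaPoly_comap_symm {W : Type} [Fintype W] [DecidableEq W] (e : V ≃ W)
    (G : SimpleGraph V) (x : ℝ) : sigmaPoly (G.comap e.symm) x = sigmaPoly G x := by
  have hcoeff : ∀ i, sigmaCoeff (G.comap e.symm) i = sigmaCoeff G i := fun i => by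
    refine (Nat.card_congr (e.finsetCongr.finsetCongr.subtypeEquiv fun F => ?_)).symm
    have hall : ∀ P : Finset W → Prop, (∀ p ∈ e.finsetCongr.finsetCongr F, P p) ↔
        ∀ p ∈ F, P (p.map e.toEmbedding) := fun P => Finset.forall_mem_map
    have hsup : (e.finsetCongr.finsetCongr F).sup id = univ ↔ F.sup id = univ := by
      have hex : ∀ v, (∃ p ∈ e.finsetCongr.finsetCongr F, e v ∈ p) ↔ ∃ p ∈ F, v ∈ p := fun v => by
        have := (hall fun p => e v ∉ p).not
        push Not at this
        simpa using this
      simp only [Finset.eq_univ_iff_forall, Finset.mem_sup, id_eq]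
      rw [← e.forall_congr_right]
      exact forall_congr' fun v => (hex v)
    simp only [hsup, hall, Finset.forall_mem_map]
    simp
  simp [sigmaPoly, hcoeff, Fintype.card_congr e]

end General

section StarTree

/-- The parent map of the rooted tree whose root has `k` leaf children and `l` further children,
each of which has `n` leaf children. -/
def starTreeParent (k l n : ℕ) :
    Option (Fin k ⊕ Fin l × Option (Fin n)) → Option (Fin k ⊕ Fin l × Option (Fin n))
  | some (.inr (i, some _)) => some (.inr (i, none))
  | _ => none

/-- The complement of the tree with parent map `starTreeParent`. -/
def starTreeCompl (k l n : ℕ) : SimpleGraph (Option (Fin k ⊕ Fin l × Option (Fin n))) where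
  Adj u v := u ≠ v ∧ starTreeParent k l n u ≠ v ∧ starTreeParent k l n v ≠ u
  symm := ⟨fun _ _ h => ⟨h.1.symm, h.2.2, h.2.1⟩⟩
  loopless := ⟨fun _ h => h.1 rfl⟩

variable {k l n : ℕ}

theorem starTreeCompl_compl_adj {u v : Option (Fin k ⊕ Fin l × Option (Fin n))} :
    (starTreeCompl k l n)ᶜ.Adj u v ↔
      u ≠ v ∧ (starTreeParent k l n u = v ∨ starTreeParent k l n v = u) := by
  simp only [SimpleGraph.compl_adj, starTreeCompl]
  tauto

theorem starTreeCompl_compl_cliqueFree : (starTreeCompl k l n)ᶜ.CliqueFree 3 := by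
  intro s hs
  obtain ⟨a, b, c, hab, hac, hbc, -⟩ := SimpleGraph.is3Clique_iff.1 hs
  rw [starTreeCompl_compl_adj] at hab hac hbc
  rcases a with _ | a | ⟨i, _ | a⟩ <;> rcases b with _ | b | ⟨i', _ | b⟩ <;>
    rcases c with _ | c | ⟨i'', _ | c⟩ <;> simp_all [starTreeParent]

/-- The vertices of the tree other than the root and its `l` children of the second kind. -/
def starTreeLeaves (k l n : ℕ) : Finset (Option (Fin k ⊕ Fin l × Option (Fin n))) :=
  {v | v ≠ none ∧ ∀ i, v ≠ some (.inr (i, none))}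

theorem sigmaOn_starTreeCompl_union {x : ℝ} (I : Finset (Fin l)) :
    ∀ D ⊆ starTreeLeaves k l n, (∀ i ∈ I, ∀ j, some (.inr (i, some j)) ∈ D) →
      sigmaOn (starTreeCompl k l n) (D ∪ I.image fun i => some (.inr (i, none))) x =
        x ^ D.card * (x + n) ^ I.card := by
  classical
  induction I using Finset.induction_on with
  | empty =>
    intro D hD _
    rw [Finset.image_empty, Finset.union_empty,
      sigmaOn_of_forall_not_compl_adj starTreeCompl_compl_cliqueFree]
    · simp
    · intro u hu v hv
      have hu := hD hu
      have hv := hD hv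
      rw [starTreeCompl_compl_adj]
      rcases u with _ | u | ⟨i, _ | u⟩ <;> rcases v with _ | v | ⟨i', _ | v⟩ <;>
        simp_all [starTreeParent, starTreeLeaves]
  | insert i I hi ih =>
    intro D hD hI
    have hDn : ∀ i, some (.inr (i, none)) ∉ D := fun i h => by
      simpa [starTreeLeaves] using hD h
    have hDr : none ∉ D := fun h => by simpa [starTreeLeaves] using hD h
    have herase : (D ∪ (insert i I).image fun i => some (Sum.inr (i, none))).erase
        (some (.inr (i, none))) = D ∪ I.image fun i => some (Sum.inr (i, none)) := by
      ext v
      simp only [mem_erase, mem_union, mem_image, mem_insert]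
      grind
    have hnbr : ({u ∈ D ∪ (insert i I).image fun i => some (Sum.inr (i, none)) |
        (starTreeCompl k l n)ᶜ.Adj (some (.inr (i, none))) u} : Finset _) =
        univ.image fun j : Fin n => some (Sum.inr (i, some j)) := by
      ext v
      simp only [mem_filter, starTreeCompl_compl_adj]
      rcases v with _ | v | ⟨i', _ | v⟩ <;>
        (simp_all [starTreeParent]; try grind)
    have hterm : ∀ j : Fin n, sigmaOn (starTreeCompl k l n)
        ((D ∪ I.image fun i => some (Sum.inr (i, none))).erase (some (.inr (i, some j)))) x =
        x ^ (D.card - 1) * (x + n) ^ I.card := fun j => by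
      have hj : some (Sum.inr (i, some j)) ∈ D := hI i (mem_insert_self i I) j
      rw [Finset.erase_union_distrib, Finset.erase_eq_of_notMem (s := I.image _) (by simp),
        ih _ ((Finset.erase_subset _ _).trans hD) fun i' hi' j' => mem_erase.2
          ⟨by rintro h; simp at h; exact hi (h.1 ▸ hi'), hI i' (mem_insert_of_mem hi') j'⟩,
        Finset.card_erase_of_mem hj]
    have hpow : (n : ℝ) * x ^ (D.card - 1) * x = n * x ^ D.card := by
      rcases n.eq_zero_or_pos with rfl | hn
      · simp
      · have := Finset.card_pos.2 ⟨_, hI i (mem_insert_self i I) ⟨0, hn⟩⟩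
        rw [mul_assoc, ← pow_succ, Nat.sub_add_cancel this]
    rw [sigmaOn_recursion (w := some (.inr (i, none))) starTreeCompl_compl_cliqueFree (by simp),
      herase, hnbr, Finset.sum_image (fun _ _ _ _ h => by simpa using h),
      ih D hD fun i' hi' => hI i' (mem_insert_of_mem hi'),
      Finset.sum_congr rfl fun j _ => hterm j, Finset.card_insert_of_notMem hi]
    simp only [Finset.sum_const, Finset.card_univ, Fintype.card_fin, nsmul_eq_mul]
    linear_combination (x + n) ^ I.card * hpow

theorem sigmaPoly_starTreeCompl (k l n : ℕ) (x : ℝ) :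
    ∃ N : ℕ, sigmaPoly (starTreeCompl k (l + 1) n) x =
      x ^ N * (x + n) ^ l * (x ^ 2 + (n + k + (l + 1)) * x + k * n) := by
  classical
  set L := starTreeLeaves k (l + 1) n with hL
  set f : Fin (l + 1) → Option (Fin k ⊕ Fin (l + 1) × Option (Fin n)) :=
    fun i => some (.inr (i, none)) with hf
  have huniv : univ.erase none = L ∪ univ.image f := by
    ext v
    rcases v with _ | v | ⟨i, _ | v⟩ <;> simp [hL, hf, starTreeLeaves]
  have hnbr : ({u | (starTreeCompl k (l + 1) n)ᶜ.Adj none u} : Finset _) =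
      (univ.image fun i : Fin k => some (Sum.inl i)) ∪ univ.image f := by
    ext v
    simp only [mem_filter, starTreeCompl_compl_adj]
    rcases v with _ | v | ⟨i, _ | v⟩ <;> simp [hf, starTreeParent]
  have hdisj : Disjoint (univ.image fun i : Fin k => some (Sum.inl i)) (univ.image f) := by
    rw [Finset.disjoint_left]
    simp [hf]
  have hleaf : ∀ i : Fin k, sigmaOn (starTreeCompl k (l + 1) n)
      ((L ∪ univ.image f).erase (some (.inl i))) x = x ^ (L.card - 1) * (x + n) ^ (l + 1) := by
    intro i
    rw [Finset.erase_union_distrib, Finset.erase_eq_of_notMem (s := univ.image f) (by simp [hf]),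
      sigmaOn_starTreeCompl_union _ (L.erase _) (Finset.erase_subset _ _) (by simp [hL, starTreeLeaves]),
      Finset.card_erase_of_mem (by simp [hL, starTreeLeaves])]
    simp
  have hcenter : ∀ i, sigmaOn (starTreeCompl k (l + 1) n)
      ((L ∪ univ.image f).erase (f i)) x = x ^ L.card * (x + n) ^ l := by
    intro i
    have : (L ∪ univ.image f).erase (f i) = L ∪ (univ.erase i).image f := by
      ext v
      rcases v with _ | v | ⟨i', _ | v⟩ <;> simp [hL, hf, starTreeLeaves]
    rw [this, sigmaOn_starTreeCompl_union _ L subset_rfl (by simp [hL, starTreeLeaves])]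
    simp
  have hpow : (k : ℝ) * x ^ (L.card - 1) * x = k * x ^ L.card := by
    rcases k.eq_zero_or_pos with rfl | hk
    · simp
    · have : 0 < L.card :=
        Finset.card_pos.2 ⟨some (.inl ⟨0, hk⟩), by simp [hL, starTreeLeaves]⟩
      rw [mul_assoc, ← pow_succ, Nat.sub_add_cancel this]
  refine ⟨L.card, ?_⟩
  rw [sigmaPoly_eq_sigmaOn,
    sigmaOn_recursion (w := none) starTreeCompl_compl_cliqueFree (mem_univ _), huniv, hnbr,
    Finset.sum_union hdisj, Finset.sum_image (fun _ _ _ _ h => by simpa using h),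
    Finset.sum_image (fun _ _ _ _ h => by simpa [hf] using h),
    Finset.sum_congr rfl fun i _ => hleaf i, Finset.sum_congr rfl fun i _ => hcenter i,
    sigmaOn_starTreeCompl_union _ L subset_rfl (by simp [hL, starTreeLeaves])]
  simp only [Finset.sum_const, Finset.card_univ, Fintype.card_fin, nsmul_eq_mul]
  push_cast
  linear_combination (x + n) ^ (l + 1) * hpow

end StarTree

open Filter Topology in
/-- The positive roots of the quadratics `y ^ 2 - (n + k + l) * y + k * n`, with natural
parameters, are dense in `(0, ∞)`. -/
theorem exists_quadratic_root_mem_Icc {a b : ℝ} (ha : 0 < a) (hab : a < b) :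
    ∃ k l n : ℕ, ∃ y ∈ Set.Icc a b, y ^ 2 - (n + k + (l + 1)) * y + k * n = 0 := by
  obtain ⟨c, hac, hcb⟩ := exists_between hab
  have hc : 0 < c := ha.trans hac
  obtain ⟨k, hk⟩ := exists_nat_gt c
  have hq : 0 ≤ (k : ℝ) / c - 1 := by
    rw [sub_nonneg, one_le_div hc]
    exact hk.le
  set q := (k : ℝ) / c - 1 with hqdef
  have hinv : Tendsto (fun n : ℕ => (1 : ℝ) / n) atTop (𝓝 0) := tendsto_one_div_atTop_nhds_zero_nat
  have hfloor : Tendsto (fun n : ℕ => (⌊q * n⌋₊ : ℝ) / n) atTop (𝓝 q) :=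
    (tendsto_nat_floor_mul_div_atTop hq).comp tendsto_natCast_atTop_atTop
  have hlim : ∀ y : ℝ, Tendsto (fun n : ℕ => (y ^ 2 - (k + 1) * y) * ((1 : ℝ) / n) - y
      - (⌊q * n⌋₊ : ℝ) / n * y + k) atTop (𝓝 (k * (1 - y / c))) := fun y => by
    convert (((hinv.const_mul (y ^ 2 - (k + 1) * y)).sub_const y).sub
      (hfloor.mul_const y)).add_const (k : ℝ) using 2
    rw [hqdef]
    ring
  have hkpos : (0 : ℝ) < k := hc.trans hk
  have hpos := (hlim a).eventually_const_lt
    (mul_pos hkpos (sub_pos.2 ((div_lt_one hc).2 hac)))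
  have hneg := (hlim b).eventually_lt_const
    (mul_neg_of_pos_of_neg hkpos (sub_neg.2 ((one_lt_div hc).2 hcb)))
  obtain ⟨n, ⟨hna, hnb⟩, hn⟩ := ((hpos.and hneg).and (eventually_gt_atTop 0)).exists
  have hn' : (0 : ℝ) < n := Nat.cast_pos.2 hn
  have hscale : ∀ y : ℝ, y ^ 2 - (n + k + (⌊q * n⌋₊ + 1)) * y + k * n =
      n * ((y ^ 2 - (k + 1) * y) * ((1 : ℝ) / n) - y - (⌊q * n⌋₊ : ℝ) / n * y + k) := fun y => by
    field_simp
    ring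
  obtain ⟨y, hy, hy0⟩ := intermediate_value_Icc' hab.le
    (f := fun y : ℝ => y ^ 2 - (n + k + (⌊q * n⌋₊ + 1)) * y + k * n)
    (Continuous.continuousOn (by fun_prop)) (show (0 : ℝ) ∈ Set.Icc _ _ from
      ⟨by rw [hscale]; exact (mul_neg_of_pos_of_neg hn' hnb).le,
        by rw [hscale]; exact (mul_pos hn' hna).le⟩)
  exact ⟨k, ⌊q * n⌋₊, n, y, hy, hy0⟩

theorem sigmaPoly_pos {V : Type} [Fintype V] [DecidableEq V] (G : SimpleGraph V) {x : ℝ}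
    (hx : 0 < x) : 0 < sigmaPoly G x := by
  rw [sigmaPoly_eq_sigmaOn]
  exact sigmaOn_pos G univ hx

theorem exists_sigmaPoly_root_mem_Icc {a b : ℝ} (hab : a < b) (hb : b < 0) :
    ∃ r ∈ Set.Icc a b, ∃ n : ℕ, 0 < n ∧ ∃ G : SimpleGraph (Fin n), sigmaPoly G r = 0 := by
  obtain ⟨k, l, n, y, hy, hy0⟩ := exists_quadratic_root_mem_Icc (neg_pos.2 hb) (neg_lt_neg hab)
  obtain ⟨N, hN⟩ := sigmaPoly_starTreeCompl k l n (-y)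
  refine ⟨-y, ⟨by linarith [hy.2], by linarith [hy.1]⟩, _, Fintype.card_pos,
    (starTreeCompl k (l + 1) n).comap (Fintype.equivFin _).symm, ?_⟩
  rw [sigmaPoly_comap_symm, hN]
  linear_combination (-y) ^ N * (-y + n) ^ l * hy0

/-- The closure in ℝ of the set of real roots of σ-polynomials of finite simple graphs
with at least one vertex is exactly `(-∞, 0]`; moreover `σ(G, x) > 0` for every real
`x > 0` and every finite simple graph `G` with at least one vertex. -/
theorem closure_of_sigma_roots_eq_Iic_zero :
    closure {r : ℝ | ∃ (n : ℕ), 0 < n ∧ ∃ G : SimpleGraph (Fin n), sigmaPoly G r = 0}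
        = Set.Iic (0 : ℝ) ∧
      ∀ (V : Type) [Fintype V] [DecidableEq V], Nonempty V →
        ∀ (G : SimpleGraph V) (x : ℝ), 0 < x → 0 < sigmaPoly G x := by
  refine ⟨Set.Subset.antisymm ?_ ?_, fun V _ _ _ G x hx => sigmaPoly_pos G hx⟩
  · refine closure_minimal ?_ isClosed_Iic
    rintro r ⟨n, -, G, hr⟩
    exact not_lt.1 fun h => (sigmaPoly_pos G h).ne' hr
  · rw [← closure_Iio' ⟨-1, by simp⟩]
    refine closure_minimal (fun x hx => Metric.mem_closure_iff.2 fun ε hε => ?_) isClosed_closure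
    obtain ⟨r, hr, h⟩ := exists_sigmaPoly_root_mem_Icc (sub_lt_self x (half_pos hε)) hx
    refine ⟨r, h, ?_⟩
    rw [Real.dist_eq, abs_of_nonneg (sub_nonneg.2 hr.2)]
    linarith [hr.1]
end

section
/- The real roots of matching polynomials of finite trees are dense in ℝ: for every real number y and every ε > 0 there exist a finite tree T and a real number r with m(T, r) = 0 and |r − y| < ε. -/
/-- `matchCount G i` is the number of matchings of size `i` in `G`, i.e. the number of
sets of `i` pairwise disjoint edges of `G`. -/
noncomputable def matchCount {V : Type} [Fintype V] [DecidableEq V]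
    (G : SimpleGraph V) (i : ℕ) : ℕ :=
  Nat.card {M : Finset (Sym2 V) // M.card = i ∧
    (∀ e ∈ M, e ∈ G.edgeSet) ∧
    (∀ e ∈ M, ∀ f ∈ M, e ≠ f → ∀ v : V, v ∈ e → v ∉ f)}

/-- The matching polynomial of `G`, evaluated at `x` :
`m(G,x) = Σ_{i ≥ 0} (−1)^i m_i(G) x^{n−2i}`. -/
noncomputable def matchPoly {V : Type} [Fintype V] [DecidableEq V]
    (G : SimpleGraph V) (x : ℝ) : ℝ :=
  ∑ i ∈ Finset.range (Fintype.card V / 2 + 1),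
    (-1 : ℝ) ^ i * (matchCount G i : ℝ) * x ^ (Fintype.card V - 2 * i)

open Finset in
/-- The sum of `w ^ #M` over the subsets `M` of `E` whose distinct elements are pairwise related
by `r`. -/
noncomputable def pairwiseSum {α : Type*} [DecidableEq α] (r : α → α → Prop) (w : ℝ) (E : Finset α) : ℝ :=
  open Classical in ∑ M ∈ E.powerset.filter fun M : Finset α => (M : Set α).Pairwise r, w ^ #M

section PairwiseSum

open Finset

variable {α β : Type*} [DecidableEq α] {r : α → α → Prop} {w : ℝ}

theorem pairwiseSum_empty : pairwiseSum r w ∅ = 1 := by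
  classical
  simp [pairwiseSum, filter_singleton]

open Classical in
theorem pairwiseSum_insert [Std.Symm r] {a : α} {E : Finset α} (ha : a ∉ E) :
    pairwiseSum r w (insert a E) = pairwiseSum r w E + w * pairwiseSum r w (E.filter (r a)) := by
  have key : (E.powerset.filter fun t : Finset α => ((insert a t : Finset α) : Set α).Pairwise r) =
      (E.filter (r a)).powerset.filter fun t : Finset α => (t : Set α).Pairwise r := by
    ext t
    simp only [mem_filter, mem_powerset, coe_insert]
    constructor
    · rintro ⟨hs, hp⟩
      have hat : a ∉ t := fun h => ha (hs h)
      rw [Set.pairwise_insert_of_symm_of_notMem (by simpa using hat)] at hp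
      exact ⟨fun x hx => mem_filter.2 ⟨hs hx, hp.2 x hx⟩, hp.1⟩
    · rintro ⟨hs, hp⟩
      have hsE : t ⊆ E := fun x hx => (mem_filter.1 (hs hx)).1
      rw [Set.pairwise_insert_of_symm_of_notMem (by simpa using fun h => ha (hsE h))]
      exact ⟨hsE, hp, fun x hx => (mem_filter.1 (hs hx)).2⟩
  unfold pairwiseSum
  rw [mul_sum, ← key, sum_filter, sum_filter, sum_filter, sum_powerset_insert ha]
  congr 1
  refine sum_congr rfl fun t ht => ?_
  rw [card_insert_of_notMem fun h => ha (mem_powerset.1 ht h), pow_succ']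

open Classical in
theorem pairwiseSum_union_of_pairwise_not [Std.Symm r] {A B : Finset α} (hAB : Disjoint A B)
    (hA : (A : Set α).Pairwise fun a b => ¬ r a b) :
    pairwiseSum r w (A ∪ B) =
      pairwiseSum r w B + w * ∑ a ∈ A, pairwiseSum r w (B.filter (r a)) := by
  induction A using Finset.induction_on with
  | empty => simp
  | insert a A ha ih =>
    rw [disjoint_insert_left] at hAB
    rw [coe_insert] at hA
    have hfilter : (A ∪ B).filter (r a) = B.filter (r a) := by
      rw [filter_union, filter_eq_empty_iff.2, empty_union]
      exact fun x hx => hA (Set.mem_insert _ _) (Set.mem_insert_of_mem _ hx)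
        (fun h => ha (h ▸ hx))
    rw [insert_union, pairwiseSum_insert (by simp [ha, hAB.1]), hfilter,
      ih hAB.2 (hA.mono (Set.subset_insert _ _)), sum_insert ha]
    ring

theorem pairwiseSum_union_of_forall_rel [Std.Symm r] {A B : Finset α} (hAB : Disjoint A B)
    (h : ∀ a ∈ A, ∀ b ∈ B, r a b) :
    pairwiseSum r w (A ∪ B) = pairwiseSum r w A * pairwiseSum r w B := by
  classical
  induction A using Finset.strongInduction with
  | H A ih =>
    rcases A.eq_empty_or_nonempty with rfl | ⟨a, ha⟩
    · simp [pairwiseSum_empty]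
    obtain ⟨A', ha', rfl⟩ : ∃ A', a ∉ A' ∧ insert a A' = A :=
      ⟨A.erase a, notMem_erase _ _, insert_erase ha⟩
    rw [disjoint_insert_left] at hAB
    have hfilter : (A' ∪ B).filter (r a) = A'.filter (r a) ∪ B := by
      rw [filter_union, filter_true_of_mem (s := B) fun b hb => h a (mem_insert_self _ _) b hb]
    have hss : A' ⊂ insert a A' := ssubset_insert ha'
    have hss' : A'.filter (r a) ⊂ insert a A' := (filter_subset _ _).trans_ssubset hss
    rw [insert_union, pairwiseSum_insert (by simp [ha', hAB.1]), pairwiseSum_insert ha',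
      hfilter, ih _ hss hAB.2 fun x hx => h x (hss.1 hx),
      ih _ hss' (hAB.2.mono_left (filter_subset _ _)) fun x hx => h x (hss'.1 hx)]
    ring

theorem pairwiseSum_map [DecidableEq β] (f : β ↪ α) (E : Finset β) :
    pairwiseSum r w (E.map f) = pairwiseSum (fun a b => r (f a) (f b)) w E := by
  classical
  unfold pairwiseSum
  symm
  refine sum_bij (fun M _ => M.map f) ?_ (fun _ _ _ _ h => map_injective f h) ?_
    (fun M _ => by simp only [card_map])
  · intro M hM
    simp only [mem_filter, mem_powerset, coe_map] at hM ⊢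
    exact ⟨map_subset_map.2 hM.1, (f.injective.injOn.pairwise_image).2 hM.2⟩
  · intro M hM
    simp only [mem_filter, mem_powerset] at hM
    obtain ⟨M', hM', rfl⟩ := subset_map_iff.1 hM.1
    refine ⟨M', ?_, rfl⟩
    have := hM.2
    rw [coe_map, f.injective.injOn.pairwise_image] at this
    simp only [mem_filter, mem_powerset]
    exact ⟨hM', this⟩

end PairwiseSum

section MatchPoly

open Finset

variable {V : Type} [Fintype V] [DecidableEq V]

theorem two_mul_card_le_of_pairwise_disjoint {G : SimpleGraph V} {M : Finset (Sym2 V)}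
    (hM : ∀ e ∈ M, e ∈ G.edgeSet)
    (hp : (M : Set (Sym2 V)).Pairwise fun e f => ∀ v, v ∈ e → v ∉ f) :
    2 * #M ≤ Fintype.card V := by
  have h1 : #(M.biUnion Sym2.toFinset) = ∑ e ∈ M, #e.toFinset := by
    refine card_biUnion fun e he f hf hef => ?_
    rw [Function.onFun, disjoint_left]
    simpa using hp he hf hef
  rw [sum_congr rfl fun e he =>
    Sym2.card_toFinset_of_not_isDiag e (G.not_isDiag_of_mem_edgeSet (hM e he))] at h1
  rw [sum_const, smul_eq_mul, mul_comm] at h1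
  exact h1 ▸ card_le_univ _

theorem matchPoly_eq_pairwiseSum (G : SimpleGraph V) {E : Finset (Sym2 V)}
    (hE : (E : Set (Sym2 V)) = G.edgeSet) {x : ℝ} (hx : x ≠ 0) :
    matchPoly G x = x ^ Fintype.card V *
      pairwiseSum (fun e f : Sym2 V => ∀ v, v ∈ e → v ∉ f) (-1 / x ^ 2) E := by
  classical
  set r : Sym2 V → Sym2 V → Prop := fun e f => ∀ v, v ∈ e → v ∉ f
  set S := E.powerset.filter fun M : Finset (Sym2 V) => (M : Set (Sym2 V)).Pairwise r with hS
  have hSM : ∀ M ∈ S, 2 * #M ≤ Fintype.card V := by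
    intro M hM
    rw [hS, mem_filter, mem_powerset] at hM
    exact two_mul_card_le_of_pairwise_disjoint (G := G)
      (fun e he => hE ▸ mem_coe.2 (hM.1 he)) hM.2
  have hcount : ∀ i, matchCount G i = #{M ∈ S | #M = i} := by
    intro i
    refine Nat.subtype_card _ fun M => ?_
    simp only [hS, mem_filter, mem_powerset, ← hE, mem_coe]
    exact ⟨fun h => ⟨h.2, h.1.1, fun e he f hf hef => h.1.2 he hf hef⟩,
      fun h => ⟨⟨h.2.1, fun e he f hf hef => h.2.2 e he f hf hef⟩, h.1⟩⟩
  have hmaps : ∀ M ∈ S, #M ∈ range (Fintype.card V / 2 + 1) := fun M hM => by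
    have := hSM M hM
    rw [mem_range]
    omega
  have hsum : pairwiseSum r (-1 / x ^ 2) E = ∑ M ∈ S, (-1 / x ^ 2) ^ #M := by
    rw [pairwiseSum, hS]
    congr
  rw [matchPoly, hsum, mul_sum, ← sum_fiberwise_of_maps_to hmaps]
  refine sum_congr rfl fun i hi => ?_
  have hi' : 2 * i ≤ Fintype.card V := by
    rw [mem_range] at hi
    omega
  rw [sum_congr rfl fun M hM => by rw [(mem_filter.1 hM).2], sum_const, hcount, nsmul_eq_mul,
    pow_sub₀ _ hx hi', div_pow, ← pow_mul]
  ring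

end MatchPoly

section DoubleBroom

open Finset

/-- The edge joining a non-root vertex to its parent, in the rooted tree whose root `none` has
`m` leaf children and `j` further children with `k` leaf children each. -/
def parentEdge (m j k : ℕ) :
    Fin m ⊕ Fin j × Option (Fin k) → Sym2 (Option (Fin m ⊕ Fin j × Option (Fin k)))
  | .inl i => s(none, some (.inl i))
  | .inr (c, none) => s(none, some (.inr (c, none)))
  | .inr (c, some l) => s(some (.inr (c, none)), some (.inr (c, some l)))

theorem parentEdge_injective (m j k : ℕ) : Function.Injective (parentEdge m j k) := by
  rintro (a | ⟨a, _ | a'⟩) (b | ⟨b, _ | b'⟩) h <;> simp_all [parentEdge]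

theorem parentEdge_not_isDiag {m j k : ℕ} (a : Fin m ⊕ Fin j × Option (Fin k)) :
    ¬ (parentEdge m j k a).IsDiag := by
  rcases a with a | ⟨a, _ | a'⟩ <;> simp [parentEdge]

/-- The rooted tree whose root has `m` leaf children and `j` further children with `k` leaf
children each. -/
def broomTree (m j k : ℕ) : SimpleGraph (Option (Fin m ⊕ Fin j × Option (Fin k))) :=
  SimpleGraph.fromEdgeSet (Set.range (parentEdge m j k))

theorem edgeSet_broomTree (m j k : ℕ) :
    (broomTree m j k).edgeSet = Set.range (parentEdge m j k) := by
  rw [broomTree, SimpleGraph.edgeSet_fromEdgeSet, sdiff_eq_left, Set.disjoint_left]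
  rintro _ ⟨a, rfl⟩ h
  exact parentEdge_not_isDiag a h

theorem isTree_broomTree (m j k : ℕ) : (broomTree m j k).IsTree := by
  have hadj : ∀ {u v} a, parentEdge m j k a = s(u, v) → (broomTree m j k).Adj u v := by
    intro u v a h
    rw [← SimpleGraph.mem_edgeSet, edgeSet_broomTree]
    exact ⟨a, h⟩
  rw [SimpleGraph.isTree_iff_connected_and_card]
  refine ⟨(SimpleGraph.connected_iff_exists_forall_reachable _).2 ⟨none, ?_⟩, ?_⟩
  · rintro (_ | a | ⟨a, _ | b⟩)
    · exact .refl _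
    · exact (hadj (.inl a) rfl).reachable
    · exact (hadj (.inr (a, none)) rfl).reachable
    · exact (hadj (.inr (a, none)) rfl).reachable.trans (hadj (.inr (a, some b)) rfl).reachable
  · rw [edgeSet_broomTree, Nat.card_range_of_injective (parentEdge_injective m j k)]
    simp

theorem pairwiseSum_parentEdge (m j k : ℕ) (w : ℝ) :
    pairwiseSum (fun a b => ∀ v, v ∈ parentEdge m j k a → v ∉ parentEdge m j k b) w univ =
      (1 + k * w) ^ j * (1 + m * w) + j * w * (1 + k * w) ^ (j - 1) := by
  classical
  obtain ⟨r, hr⟩ : ∃ r : Fin m ⊕ Fin j × Option (Fin k) → Fin m ⊕ Fin j × Option (Fin k) → Prop,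
    r = fun a b => ∀ v, v ∈ parentEdge m j k a → v ∉ parentEdge m j k b := ⟨_, rfl⟩
  rw [← hr]
  have : Std.Symm r := ⟨fun a b h => by
    rw [hr] at h ⊢
    exact fun v hb ha => h v ha hb⟩
  let star (c : Fin j) : Finset (Fin m ⊕ Fin j × Option (Fin k)) :=
    univ.image fun l => .inr (c, some l)
  have hstar : ∀ c, pairwiseSum r w (star c) = 1 + k * w := by
    intro c
    rw [← union_empty (star c), pairwiseSum_union_of_pairwise_not (disjoint_empty_right _)]
    · simp only [filter_empty, pairwiseSum_empty, sum_const, nsmul_eq_mul, mul_one]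
      rw [card_image_of_injective _ fun a b h => by simpa using h, card_univ, Fintype.card_fin]
      ring
    · intro a ha b hb _
      simp only [star, coe_image, coe_univ, Set.image_univ, Set.mem_range] at ha hb
      obtain ⟨l, rfl⟩ := ha
      obtain ⟨l', rfl⟩ := hb
      simp [hr, parentEdge]
  have hstars : ∀ S : Finset (Fin j), pairwiseSum r w (S.biUnion star) = (1 + k * w) ^ #S := by
    intro S
    induction S using Finset.induction_on with
    | empty => simp [pairwiseSum_empty]
    | insert c S hc ih =>
      rw [biUnion_insert, pairwiseSum_union_of_forall_rel, hstar, ih, card_insert_of_notMem hc,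
        pow_succ']
      · rw [disjoint_left]
        simp only [star, mem_image, mem_biUnion]
        rintro _ ⟨l, -, rfl⟩ ⟨c', hc', l', -, h⟩
        simp only [Sum.inr.injEq, Prod.mk.injEq] at h
        exact hc (h.1 ▸ hc')
      · simp only [star, mem_image, mem_biUnion]
        rintro _ ⟨l, -, rfl⟩ _ ⟨c', hc', l', -, rfl⟩
        have : c ≠ c' := fun h => hc (h ▸ hc')
        simp [hr, parentEdge, this]
  let A₁ : Finset (Fin m ⊕ Fin j × Option (Fin k)) := univ.image .inl
  let A₂ : Finset (Fin m ⊕ Fin j × Option (Fin k)) := univ.image fun c => .inr (c, none)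
  have huniv : (univ : Finset (Fin m ⊕ Fin j × Option (Fin k))) =
      (A₁ ∪ A₂) ∪ univ.biUnion star := by
    ext a
    rcases a with a | ⟨a, _ | b⟩ <;> simp [A₁, A₂, star]
  have hA₁ : ∀ i, (univ.biUnion star).filter (r (.inl i)) = univ.biUnion star := by
    intro i
    refine filter_true_of_mem ?_
    simp only [star, mem_image, mem_biUnion]
    rintro _ ⟨c', -, l', -, rfl⟩
    simp [hr, parentEdge]
  have hA₂ : ∀ c, (univ.biUnion star).filter (r (.inr (c, none))) =
      (univ.erase c).biUnion star := by
    intro c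
    ext a
    rcases a with a | ⟨a, _ | b⟩ <;> simp [star, hr, parentEdge, eq_comm]
  rw [huniv, pairwiseSum_union_of_pairwise_not, sum_union, sum_image, sum_image]
  · simp only [hA₁, hA₂, hstars, sum_const, card_univ, card_erase_of_mem (mem_univ _),
      Fintype.card_fin, nsmul_eq_mul]
    ring
  · intro a _ b _ h
    simpa using h
  · intro a _ b _ h
    simpa using h
  · rw [disjoint_left]
    simp [A₁, A₂]
  · rw [disjoint_left]
    rintro (a | ⟨a, _ | b⟩) <;> simp [A₁, A₂, star]
  · have hroot : ∀ a ∈ A₁ ∪ A₂, none ∈ parentEdge m j k a := by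
      rintro (a | ⟨a, _ | b⟩) <;> simp [A₁, A₂, parentEdge]
    intro a ha b hb _
    rw [hr]
    exact fun h => h none (hroot a ha) (hroot b hb)

/-- A nonzero number whose square solves the characteristic equation of `broomTree m j k` is a root
of the matching polynomial of a tree on an initial segment of `ℕ`. -/
theorem exists_isTree_matchPoly_eq_zero {m j k : ℕ} {x : ℝ} (hx : x ≠ 0) (hk : x ^ 2 ≠ k)
    (h : (k - x ^ 2) * (m - x ^ 2) = j * x ^ 2) :
    ∃ (n : ℕ) (T : SimpleGraph (Fin n)), T.IsTree ∧ matchPoly T x = 0 := by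
  let φ := Fintype.equivFin (Option (Fin m ⊕ Fin j × Option (Fin k)))
  let f : Fin m ⊕ Fin j × Option (Fin k) ↪ Sym2 (Fin _) :=
    ⟨fun a => Sym2.map φ (parentEdge m j k a),
      (Sym2.map.injective φ.injective).comp (parentEdge_injective m j k)⟩
  refine ⟨_, (broomTree m j k).map φ.toEmbedding,
    (SimpleGraph.Iso.map φ (broomTree m j k)).isTree_iff.1 (isTree_broomTree m j k), ?_⟩
  have hE : ((univ.map f : Finset (Sym2 (Fin _))) : Set (Sym2 (Fin _))) =
      ((broomTree m j k).map φ.toEmbedding).edgeSet := by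
    rw [SimpleGraph.edgeSet_map, edgeSet_broomTree, ← Set.range_comp, coe_map, coe_univ,
      Set.image_univ]
    rfl
  have hrel : (fun a b => ∀ v, v ∈ f a → v ∉ f b) =
      fun a b => ∀ v, v ∈ parentEdge m j k a → v ∉ parentEdge m j k b := by
    funext a b
    refine propext ⟨fun h v ha hb => h (φ v) (Sym2.mem_map.2 ⟨v, ha, rfl⟩)
      (Sym2.mem_map.2 ⟨v, hb, rfl⟩), fun h v ha hb => ?_⟩
    obtain ⟨u, hu, rfl⟩ := Sym2.mem_map.1 ha
    obtain ⟨u', hu', huu⟩ := Sym2.mem_map.1 hb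
    exact h u hu (φ.injective huu ▸ hu')
  rw [matchPoly_eq_pairwiseSum _ hE hx, pairwiseSum_map, hrel, pairwiseSum_parentEdge]
  refine mul_eq_zero_of_right _ ?_
  have hx2 : x ^ 2 ≠ 0 := pow_ne_zero 2 hx
  have hne : 1 + (k : ℝ) * (-1 / x ^ 2) ≠ 0 := by
    intro h0
    field_simp at h0
    exact hk (by linarith)
  have hpoly : (1 + (k : ℝ) * (-1 / x ^ 2)) * (1 + m * (-1 / x ^ 2)) + j * (-1 / x ^ 2) = 0 := by
    field_simp
    linear_combination h
  rcases j with _ | j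
  · simp only [Nat.cast_zero, zero_mul, add_zero] at hpoly ⊢
    simpa [hne] using hpoly
  · rw [Nat.add_sub_cancel, pow_succ]
    linear_combination (1 + (k : ℝ) * (-1 / x ^ 2)) ^ j * hpoly

end DoubleBroom

theorem exists_nat_root_between {a b : ℝ} (ha : 0 ≤ a) (hab : a < b) :
    ∃ (m j k : ℕ) (t : ℝ), a < t ∧ t < b ∧ t ≠ k ∧ (k - t) * (m - t) = j * t := by
  obtain ⟨q, haq, hqb⟩ := exists_rat_btwn hab
  obtain ⟨s, has, hsq⟩ := exists_between haq
  have hq0 : (0 : ℝ) < q := ha.trans_lt haq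
  obtain ⟨p, hp⟩ := Int.eq_ofNat_of_zero_le (Rat.num_nonneg.2 (Rat.cast_pos.1 hq0).le)
  have hd : (1 : ℝ) ≤ q.den := by exact_mod_cast q.den_pos
  have hpd : (p : ℝ) = q.den * q := by
    have h1 : (q.den * q : ℚ) = p := by
      rw [Rat.den_mul_eq_num, hp]
      simp
    exact_mod_cast h1.symm
  have hgap : 0 < (q.den : ℝ) * (q - s) := mul_pos (by linarith) (by linarith)
  obtain ⟨k, hk⟩ := exists_nat_gt (max (q : ℝ) (s * (p - s) / (q.den * (q - s))))
  obtain ⟨hkq, hks⟩ := max_lt_iff.1 hk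
  rw [div_lt_iff₀ hgap] at hks
  let F : ℝ → ℝ := fun t => (k - t) * (p - t) - ((q.den - 1 : ℕ) * k : ℕ) * t
  have hF : ∀ t, F t = k * (q.den * (q - t)) - t * (p - t) := by
    intro t
    simp only [F]
    push_cast [Nat.cast_sub (show 1 ≤ q.den from q.den_pos)]
    rw [hpd]
    ring
  have hcont : ContinuousOn F (Set.Icc s q) := by
    simp only [F]
    fun_prop
  have h0 : (0 : ℝ) ∈ Set.Icc (F q) (F s) := by
    constructor
    · rw [hF, hpd]
      have : 0 ≤ (q : ℝ) * (q.den * q - q) := mul_nonneg hq0.le (by nlinarith)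
      linarith
    · rw [hF]
      linarith
  obtain ⟨t, ⟨hst, htq⟩, ht⟩ := intermediate_value_Icc' hsq.le hcont h0
  exact ⟨p, (q.den - 1) * k, k, t, by linarith, by linarith, by linarith, sub_eq_zero.1 ht⟩

/-- The real roots of matching polynomials of finite trees are dense in ℝ. -/
theorem tree_matching_roots_dense (y ε : ℝ) (hε : 0 < ε) :
    ∃ (m : ℕ) (T : SimpleGraph (Fin m)) (r : ℝ),
      T.IsTree ∧ matchPoly T r = 0 ∧ |r - y| < ε := by
  have hlt : |y| ^ 2 < (|y| + ε) ^ 2 := by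
    have := abs_nonneg y
    gcongr
    linarith
  obtain ⟨m, j, k, t, hat, htb, htk, ht⟩ := exists_nat_root_between (sq_nonneg |y|) hlt
  have ht0 : 0 < t := (sq_nonneg _).trans_lt hat
  have h1 : |y| < √t := Real.lt_sqrt_of_sq_lt hat
  have h2 : √t < |y| + ε := (Real.sqrt_lt' (by positivity)).2 htb
  obtain ⟨r, hr, hry⟩ : ∃ r : ℝ, r ^ 2 = t ∧ |r - y| < ε := by
    rcases le_total 0 y with hy | hy
    · rw [abs_of_nonneg hy] at h1 h2
      exact ⟨√t, Real.sq_sqrt ht0.le, abs_lt.2 ⟨by linarith, by linarith⟩⟩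
    · rw [abs_of_nonpos hy] at h1 h2
      exact ⟨-√t, by rw [neg_sq, Real.sq_sqrt ht0.le], abs_lt.2 ⟨by linarith, by linarith⟩⟩
  subst hr
  obtain ⟨n, T, hT, hroot⟩ :=
    exists_isTree_matchPoly_eq_zero (fun h => by simp [h] at ht0) htk ht
  exact ⟨n, T, r, hT, hroot, hry⟩
end

section
/- For every ε with 0 < ε < 1 there exists N such that for all n ≥ N, the polynomial Σ_{i=1}^{n} S(n, i) x^i has a real root in the open interval (−n·e, −n·(1−ε)·e), where S(n, i) is the Stirling number of the second kind and e is Euler's number. (The polynomial Σ_{i=1}^{n} S(n,i) x^i is the σ-polynomial of the edgeless graph on n vertices.) -/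
/-- The Stirling numbers of the second kind: `stirling2 n i` is the number of partitions
of an `n`-element set into `i` nonempty blocks. -/
def stirling2 : ℕ → ℕ → ℕ
  | 0, 0 => 1
  | 0, _ + 1 => 0
  | _ + 1, 0 => 0
  | n + 1, i + 1 => (i + 1) * stirling2 n (i + 1) + stirling2 n i

open Polynomial

theorem card_roots_toFinset_le_sub_derivative {p : ℝ[X]} (hp : p ≠ 0)
    (hq : p - derivative p ≠ 0) :
    p.roots.toFinset.card ≤
      ((p - derivative p).roots.toFinset \ p.roots.toFinset).card + 1 := by
  refine Finset.card_le_sdiff_of_interleaved fun x hx y hy hxy _ => ?_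
  rw [Multiset.mem_toFinset, mem_roots hp, IsRoot.def] at hx hy
  have hder (z : ℝ) : HasDerivAt (fun z => Real.exp (-z) * p.eval z)
      (-(Real.exp (-z) * (p - derivative p).eval z)) z := by
    refine ((hasDerivAt_neg z).exp.mul (p.hasDerivAt z)).congr_deriv ?_
    rw [eval_sub]
    ring
  obtain ⟨z, hz1, hz2⟩ := exists_hasDerivAt_eq_zero hxy
    (fun z _ => (hder z).continuousAt.continuousWithinAt) (by simp [hx, hy])
    (fun z _ => hder z)
  refine ⟨z, ?_, hz1⟩
  rw [Multiset.mem_toFinset, mem_roots hq, IsRoot.def]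
  simpa [(Real.exp_pos _).ne'] using hz2

theorem card_roots_le_sub_derivative {p : ℝ[X]} (hp : p ≠ 0) (hq : p - derivative p ≠ 0) :
    Multiset.card p.roots ≤ Multiset.card (p - derivative p).roots + 1 := by
  have hmult (x : ℝ) : p.rootMultiplicity x - 1 ≤ (p - derivative p).rootMultiplicity x := by
    rw [le_rootMultiplicity_iff hq]
    refine dvd_sub ((pow_dvd_pow _ (Nat.sub_le _ _)).trans (pow_rootMultiplicity_dvd p x)) ?_
    exact pow_sub_one_dvd_derivative_of_pow_dvd (pow_rootMultiplicity_dvd p x)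
  calc
    Multiset.card p.roots = ∑ x ∈ p.roots.toFinset, p.roots.count x :=
      (Multiset.toFinset_sum_count_eq _).symm
    _ = ∑ x ∈ p.roots.toFinset, (p.roots.count x - 1 + 1) :=
      (Eq.symm <| Finset.sum_congr rfl fun _ hx => tsub_add_cancel_of_le <|
        Nat.succ_le_iff.2 <| Multiset.count_pos.2 <| Multiset.mem_toFinset.1 hx)
    _ = (∑ x ∈ p.roots.toFinset, (p.rootMultiplicity x - 1)) + p.roots.toFinset.card := by
      simp only [Finset.sum_add_distrib, Finset.card_eq_sum_ones, count_roots]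
    _ ≤ (∑ x ∈ p.roots.toFinset, (p - derivative p).rootMultiplicity x) +
          (((p - derivative p).roots.toFinset \ p.roots.toFinset).card + 1) :=
      add_le_add (Finset.sum_le_sum fun x _ => hmult x)
        (card_roots_toFinset_le_sub_derivative hp hq)
    _ ≤ (∑ x ∈ p.roots.toFinset, (p - derivative p).roots.count x) +
          ((∑ x ∈ (p - derivative p).roots.toFinset \ p.roots.toFinset,
            (p - derivative p).roots.count x) + 1) := by
      simp only [← count_roots, Finset.card_eq_sum_ones]
      gcongr with x hx
      rw [Nat.succ_le_iff, Multiset.count_pos, ← Multiset.mem_toFinset]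
      exact (Finset.mem_sdiff.1 hx).1
    _ = Multiset.card (p - derivative p).roots + 1 := by
      rw [← add_assoc, ← Finset.sum_union Finset.disjoint_sdiff, Finset.union_sdiff_self_eq_union,
        ← Multiset.toFinset_sum_count_eq, ← Finset.sum_subset Finset.subset_union_right]
      intro x _ hx₂
      simpa only [Multiset.mem_toFinset, Multiset.count_eq_zero] using hx₂

theorem splits_of_natDegree_le_card_roots_add_one {K : Type*} [Field K] {p : K[X]}
    (h : p.natDegree ≤ Multiset.card p.roots + 1) : p.Splits := by
  obtain ⟨q, hq, hdeg, hroots⟩ := exists_prod_multiset_X_sub_C_mul p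
  rcases (by omega : q.natDegree = 0 ∨ q.natDegree = 1) with h0 | h1
  · exact splits_iff_card_roots.2 (by omega)
  · have := (Splits.of_natDegree_eq_one h1).natDegree_eq_card_roots
    simp [hroots, h1] at this

theorem natDegree_sub_derivative {p : ℝ[X]} (hp : p.Monic) :
    (p - derivative p).natDegree = p.natDegree ∧ (p - derivative p).Monic := by
  have hlt : (derivative p).degree < p.degree := degree_derivative_lt hp.ne_zero
  exact ⟨natDegree_eq_of_degree_eq (degree_sub_eq_left_of_degree_lt hlt), hp.sub_of_left hlt⟩

/-- If all roots of `p` are real, then so are those of `p - p'`. -/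
theorem splits_sub_derivative {p : ℝ[X]} (hp : p.Monic) (hs : p.Splits) :
    (p - derivative p).Splits := by
  obtain ⟨hdeg, hmonic⟩ := natDegree_sub_derivative hp
  refine splits_of_natDegree_le_card_roots_add_one ?_
  rw [hdeg, hs.natDegree_eq_card_roots]
  exact card_roots_le_sub_derivative hp.ne_zero hmonic.ne_zero

theorem Multiset.hasDerivAt_sum_one_div_sub {s : Multiset ℝ} {x : ℝ} (hx : ∀ z ∈ s, z < x) :
    HasDerivAt (fun y => (s.map fun z => 1 / (y - z)).sum)
      (-(s.map fun z => 1 / (x - z) ^ 2).sum) x := by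
  induction s using Multiset.induction_on with
  | empty => simpa using hasDerivAt_const x (0 : ℝ)
  | cons a s ih =>
    simp only [Multiset.map_cons, Multiset.sum_cons]
    have ha : x - a ≠ 0 := (sub_pos.2 (hx a (Multiset.mem_cons_self a s))).ne'
    refine ((((hasDerivAt_id x).sub_const a).inv ha).add
      (ih fun z hz => hx z (Multiset.mem_cons_of_mem hz))).congr_of_eventuallyEq ?_ |>.congr_deriv ?_
    · exact Filter.Eventually.of_forall fun y => by simp
    · simp only [id]; ring

theorem Multiset.sum_map_one_div_sub_anti {s : Multiset ℝ} {x y : ℝ} (hx : ∀ z ∈ s, z < x)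
    (hxy : x ≤ y) :
    (s.map fun z => 1 / (y - z)).sum ≤ (s.map fun z => 1 / (x - z)).sum :=
  Multiset.sum_map_le_sum_map _ _ fun z hz =>
    one_div_le_one_div_of_le (sub_pos.2 (hx z hz)) (by linarith)

theorem Multiset.mul_sum_map_one_div_sub_sq_anti {s : Multiset ℝ} {x y : ℝ}
    (h0 : ∀ z ∈ s, 0 ≤ z) (hx0 : 0 < x) (hx : ∀ z ∈ s, z < x) (hxy : x ≤ y) :
    y * (s.map fun z => 1 / (y - z) ^ 2).sum ≤ x * (s.map fun z => 1 / (x - z) ^ 2).sum := by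
  rw [← Multiset.sum_map_mul_left, ← Multiset.sum_map_mul_left]
  refine Multiset.sum_map_le_sum_map _ _ fun z hz => ?_
  have hz0 := h0 z hz
  have hzx := sub_pos.2 (hx z hz)
  have hzy : 0 < y - z := by linarith
  rw [mul_one_div, mul_one_div, div_le_div_iff₀ (by positivity) (by positivity)]
  have : z ^ 2 ≤ x * y := by nlinarith
  nlinarith [mul_nonneg (sub_nonneg.2 hxy) (sub_nonneg.2 this)]

/-- If the barrier function `y * (1 - ∑ 1 / (y - z))` of a nonnegative multiset is at least `ρ` at a
point `y₀` above it, then the barrier function of the roots of `X * (p - p')`, with `p` the monic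
polynomial with those roots, is at least `ρ` at `y₀ * exp (1 / ρ)`. -/
theorem Multiset.le_barrier_mul_exp {s : Multiset ℝ} (h0 : ∀ z ∈ s, 0 ≤ z) {ρ y₀ : ℝ} (hρ : 0 < ρ)
    (hy₀ : 0 < y₀) (hs : ∀ z ∈ s, z < y₀)
    (hR : ρ ≤ y₀ * (1 - (s.map fun z => 1 / (y₀ - z)).sum)) {y : ℝ}
    (hy : y = y₀ * Real.exp (1 / ρ)) :
    ρ ≤ y * (1 - (s.map fun z => 1 / (y - z)).sum) - 1 -
      y * (s.map fun z => 1 / (y - z) ^ 2).sum / (1 - (s.map fun z => 1 / (y - z)).sum) := by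
  set g : ℝ → ℝ := fun y => 1 - (s.map fun z => 1 / (y - z)).sum with hg
  set S : ℝ → ℝ := fun y => (s.map fun z => 1 / (y - z) ^ 2).sum with hS
  change ρ ≤ y * g y - 1 - y * S y / g y
  replace hR : ρ ≤ y₀ * g y₀ := hR
  have hg₀ : 0 < g y₀ := pos_of_mul_pos_right (hρ.trans_le hR) hy₀.le
  have hyy : y₀ ≤ y := by
    rw [hy]; exact le_mul_of_one_le_right hy₀.le (Real.one_le_exp (by positivity))
  have hypos : 0 < y := hy₀.trans_le hyy
  have hlt {x : ℝ} (hx : y₀ ≤ x) : ∀ z ∈ s, z < x := fun z hz => (hs z hz).trans_le hx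
  have hgmono {a b : ℝ} (ha : y₀ ≤ a) (hab : a ≤ b) : g a ≤ g b :=
    sub_le_sub_left (Multiset.sum_map_one_div_sub_anti (hlt ha) hab) 1
  have hgpos {x : ℝ} (hx : y₀ ≤ x) : 0 < g x := hg₀.trans_le (hgmono le_rfl hx)
  have hSnonneg (x : ℝ) : 0 ≤ S x := Multiset.sum_nonneg (by
    intro a ha
    obtain ⟨z, -, rfl⟩ := Multiset.mem_map.1 ha
    positivity)
  set m := 1 + y * S y / g y with hm
  have hder {x : ℝ} (hx : y₀ ≤ x) :
      HasDerivAt (fun x => Real.log (g x) + (1 - m) * Real.log x)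
        (S x / g x + (1 - m) * x⁻¹) x := by
    have hx0 : x ≠ 0 := (hy₀.trans_le hx).ne'
    have h1 : HasDerivAt g (S x) x := by
      simpa only [neg_neg] using (Multiset.hasDerivAt_sum_one_div_sub (hlt hx)).const_sub 1
    exact (h1.log (hgpos hx).ne').add ((Real.hasDerivAt_log hx0).const_mul _)
  have hmono : MonotoneOn (fun x => Real.log (g x) + (1 - m) * Real.log x) (Set.Icc y₀ y) := by
    refine monotoneOn_of_deriv_nonneg (convex_Icc _ _)
      (fun x hx => (hder hx.1).continuousAt.continuousWithinAt)
      (fun x hx => (hder (interior_subset hx).1).differentiableAt.differentiableWithinAt)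
      fun x hx => ?_
    obtain ⟨hx1, hx2⟩ := interior_subset hx
    have hx0 : 0 < x := hy₀.trans_le hx1
    rw [(hder hx1).deriv]
    have : y * S y / g y ≤ x * S x / g x :=
      div_le_div₀ (mul_nonneg hx0.le (hSnonneg x))
        (Multiset.mul_sum_map_one_div_sub_sq_anti h0 hx0 (hlt hx1) hx2) (hgpos hx1)
        (hgmono hx1 hx2)
    have h2 : S x / g x + (1 - m) * x⁻¹ = (x * S x / g x - y * S y / g y) / x := by
      rw [hm]; field_simp; ring
    rw [h2]
    exact div_nonneg (sub_nonneg.2 this) hx0.le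
  have hcmp := hmono (Set.left_mem_Icc.2 hyy) (Set.right_mem_Icc.2 hyy) hyy
  have hlogy : Real.log y = Real.log y₀ + 1 / ρ := by
    rw [hy, Real.log_mul hy₀.ne' (Real.exp_pos _).ne', Real.log_exp]
  have hlog : Real.log ρ + m / ρ ≤ Real.log (y * g y) := by
    have h1 : Real.log ρ ≤ Real.log (y₀ * g y₀) := Real.log_le_log hρ hR
    rw [Real.log_mul hy₀.ne' hg₀.ne'] at h1
    rw [Real.log_mul hypos.ne' (hgpos hyy).ne']
    simp only [hlogy] at hcmp ⊢
    have : m / ρ = m * (1 / ρ) := by ring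
    rw [this]
    linarith
  have hexp : ρ * (m / ρ + 1) ≤ y * g y := by
    have h1 := Real.exp_le_exp.2 hlog
    rw [Real.exp_add, Real.exp_log hρ, Real.exp_log (mul_pos hypos (hgpos hyy))] at h1
    exact (mul_le_mul_of_nonneg_left (Real.add_one_le_exp _) hρ.le).trans h1
  have : ρ * (m / ρ + 1) = m + ρ := by field_simp
  linarith

/-- The Touchard polynomial with alternating signs, `(-1) ^ n * ∑ i, S(n, i) * (-X) ^ i`. -/
noncomputable def signedTouchard : ℕ → ℝ[X]
  | 0 => 1
  | n + 1 => X * (signedTouchard n - derivative (signedTouchard n))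

theorem signedTouchard_zero : signedTouchard 0 = 1 := rfl

theorem signedTouchard_succ (n : ℕ) :
    signedTouchard (n + 1) = X * (signedTouchard n - derivative (signedTouchard n)) := rfl

theorem signedTouchard_monic (n : ℕ) : (signedTouchard n).Monic := by
  induction n with
  | zero => exact monic_one
  | succ n ih => exact monic_X.mul (natDegree_sub_derivative ih).2

theorem signedTouchard_natDegree (n : ℕ) : (signedTouchard n).natDegree = n := by
  induction n with
  | zero => exact natDegree_one
  | succ n ih =>
    obtain ⟨h1, h2⟩ := natDegree_sub_derivative (signedTouchard_monic n)
    rw [signedTouchard_succ, monic_X.natDegree_mul h2, natDegree_X, h1, ih, add_comm]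

theorem signedTouchard_splits (n : ℕ) : (signedTouchard n).Splits := by
  induction n with
  | zero => exact Splits.one
  | succ n ih => exact Splits.X.mul (splits_sub_derivative (signedTouchard_monic n) ih)

theorem card_roots_signedTouchard (n : ℕ) : Multiset.card (signedTouchard n).roots = n := by
  rw [← (signedTouchard_splits n).natDegree_eq_card_roots, signedTouchard_natDegree]

theorem mem_roots_signedTouchard {n : ℕ} {x : ℝ} :
    x ∈ (signedTouchard n).roots ↔ (signedTouchard n).eval x = 0 :=
  mem_roots (signedTouchard_monic n).ne_zero

theorem eval_signedTouchard_succ {n : ℕ} {x : ℝ} (hx : (signedTouchard n).eval x ≠ 0) :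
    (signedTouchard (n + 1)).eval x = x * ((signedTouchard n).eval x *
      (1 - ((signedTouchard n).roots.map fun z => 1 / (x - z)).sum)) := by
  rw [← (signedTouchard_splits n).eval_derivative_div_eval_of_ne_zero hx, signedTouchard_succ,
    eval_mul, eval_X, eval_sub]
  field_simp

theorem nonneg_of_mem_roots_signedTouchard {n : ℕ} :
    ∀ x ∈ (signedTouchard n).roots, 0 ≤ x := by
  induction n with
  | zero => simp [signedTouchard_zero]
  | succ n ih =>
    intro x hx
    by_contra! hneg
    rw [mem_roots_signedTouchard] at hx
    have hne : (signedTouchard n).eval x ≠ 0 := fun h =>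
      hneg.not_ge (ih x (mem_roots_signedTouchard.2 h))
    rw [eval_signedTouchard_succ hne] at hx
    have hsum : ((signedTouchard n).roots.map fun z => 1 / (x - z)).sum ≤ 0 := by
      rw [← neg_nonneg, ← Multiset.sum_map_neg]
      refine Multiset.sum_nonneg fun a ha => ?_
      obtain ⟨z, hz, rfl⟩ := Multiset.mem_map.1 ha
      rw [neg_nonneg]
      exact one_div_nonpos.2 (by linarith [ih z hz])
    have := mul_ne_zero hneg.ne (mul_ne_zero hne (by linarith :
      (1 - ((signedTouchard n).roots.map fun z => 1 / (x - z)).sum) ≠ 0))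
    exact this hx

theorem coeff_signedTouchard (n i : ℕ) :
    (signedTouchard n).coeff i = (-1) ^ (n + i) * (stirling2 n i : ℝ) := by
  induction n generalizing i with
  | zero => cases i <;> simp [signedTouchard_zero, stirling2, coeff_one]
  | succ n ih =>
    cases i with
    | zero => simp [signedTouchard_succ, stirling2]
    | succ i =>
      rw [signedTouchard_succ, coeff_X_mul, coeff_sub, coeff_derivative, ih, ih, stirling2]
      push_cast
      ring

theorem sum_stirling2_mul_neg_pow {n : ℕ} (hn : n ≠ 0) (y : ℝ) :
    ∑ i ∈ Finset.Icc 1 n, (stirling2 n i : ℝ) * (-y) ^ i =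
      (-1) ^ n * (signedTouchard n).eval y := by
  have hsub : Finset.Icc 1 n ⊆ Finset.range (n + 1) := fun i hi => by
    simp only [Finset.mem_Icc, Finset.mem_range] at *; omega
  rw [eval_eq_sum_range, signedTouchard_natDegree, Finset.mul_sum]
  refine (Finset.sum_congr rfl fun i _ => ?_).trans (Finset.sum_subset hsub fun i hi hi' => ?_)
  · rw [coeff_signedTouchard, neg_pow y i, pow_add]
    rcases neg_one_pow_eq_or ℝ n with h | h <;> rw [h] <;> ring
  · obtain rfl : i = 0 := by
      simp only [Finset.mem_Icc, Finset.mem_range] at *; omega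
    obtain ⟨m, rfl⟩ := Nat.exists_eq_succ_of_ne_zero hn
    simp [coeff_signedTouchard, stirling2]

/-- All roots of `signedTouchard n` lie below `ρ * exp (n / ρ)`, where the barrier function is at
least `ρ`. -/
theorem roots_signedTouchard_lt_and_le (n : ℕ) {ρ : ℝ} (hρ : 0 < ρ) :
    (∀ z ∈ (signedTouchard n).roots, z < ρ * Real.exp (n / ρ)) ∧
      ρ ≤ ρ * Real.exp (n / ρ) *
        (1 - ((signedTouchard n).roots.map fun z => 1 / (ρ * Real.exp (n / ρ) - z)).sum) := by
  induction n with
  | zero => simp [signedTouchard_zero]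
  | succ n ih =>
    obtain ⟨hs, hR⟩ := ih
    set p := signedTouchard n with hp
    set y₀ := ρ * Real.exp (n / ρ) with hy₀
    set y := ρ * Real.exp ((n + 1 : ℕ) / ρ) with hy
    have hyy : y = y₀ * Real.exp (1 / ρ) := by
      rw [hy, hy₀, mul_assoc, ← Real.exp_add]; congr 2; push_cast; ring
    have hy₀pos : 0 < y₀ := by positivity
    have hle : y₀ ≤ y := by
      rw [hyy]; exact le_mul_of_one_le_right hy₀pos.le (Real.one_le_exp (by positivity))
    have hg₀ : 0 < 1 - (p.roots.map fun z => 1 / (y₀ - z)).sum :=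
      pos_of_mul_pos_right (hρ.trans_le hR) hy₀pos.le
    have hg {x : ℝ} (hx : y₀ ≤ x) : 0 < 1 - (p.roots.map fun z => 1 / (x - z)).sum :=
      hg₀.trans_le (sub_le_sub_left (Multiset.sum_map_one_div_sub_anti hs hx) 1)
    have hne {x : ℝ} (hx : y₀ ≤ x) : p.eval x ≠ 0 := fun h =>
      (hs x (mem_roots_signedTouchard.2 h)).not_ge hx
    have hne' {x : ℝ} (hx : y₀ ≤ x) : (signedTouchard (n + 1)).eval x ≠ 0 := by
      rw [eval_signedTouchard_succ (hne hx)]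
      exact mul_ne_zero (hy₀pos.trans_le hx).ne' (mul_ne_zero (hne hx) (hg hx).ne')
    refine ⟨fun z hz => ?_, ?_⟩
    · by_contra! h
      exact hne' (hle.trans h) (mem_roots_signedTouchard.1 hz)
    · have hlt : ∀ z ∈ p.roots, z < y := fun z hz => (hs z hz).trans_le hle
      have hypos : 0 < y := hy₀pos.trans_le hle
      refine (Multiset.le_barrier_mul_exp (fun z hz => nonneg_of_mem_roots_signedTouchard z hz)
        hρ hy₀pos hs hR hyy).trans_eq ?_
      have hev : (fun x => (signedTouchard (n + 1)).eval x) =ᶠ[nhds y] fun x => x * (p.eval x *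
          (1 - (p.roots.map fun z => 1 / (x - z)).sum)) := by
        have : ∀ᶠ x in nhds y, p.eval x ≠ 0 := p.continuous.continuousAt.eventually_ne (hne hle)
        filter_upwards [this] with x hx using eval_signedTouchard_succ hx
      have hd := (((hasDerivAt_id y).mul ((p.hasDerivAt y).mul
        ((Multiset.hasDerivAt_sum_one_div_sub hlt).const_sub 1))).congr_of_eventuallyEq hev).unique
          ((signedTouchard (n + 1)).hasDerivAt y)
      have hlog : (derivative p).eval y =
          p.eval y * (p.roots.map fun z => 1 / (y - z)).sum := by
        rw [← (signedTouchard_splits n).eval_derivative_div_eval_of_ne_zero (hne hle)]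
        rw [mul_div_cancel₀ _ (hne hle)]
      rw [← (signedTouchard_splits (n + 1)).eval_derivative_div_eval_of_ne_zero (hne' hle), ← hd,
        eval_signedTouchard_succ (hne hle), hlog]
      have h1 := hne hle
      have h2 := (hg hle).ne'
      simp only [id, Pi.mul_apply, ← hp]
      generalize (p.roots.map fun z => 1 / (y - z)).sum = Φ at *
      generalize (p.roots.map fun z => 1 / (y - z) ^ 2).sum = S at *
      field_simp
      ring

theorem lt_of_mem_roots_signedTouchard {n : ℕ} (hn : n ≠ 0) {z : ℝ}
    (hz : z ∈ (signedTouchard n).roots) : z < n * Real.exp 1 := by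
  have hn' : (0 : ℝ) < n := by positivity
  simpa [hn'.ne'] using (roots_signedTouchard_lt_and_le n hn').1 z hz

theorem Polynomial.reverse_X_sub_C (a : ℝ) : reverse (X - C a) = 1 - C a * X := by
  ext k
  rw [coeff_reverse, natDegree_X_sub_C]
  match k with
  | 0 => simp [revAt_le]
  | 1 => simp [revAt_le, coeff_one]
  | k + 2 =>
    rw [revAt_eq_self_of_lt (by omega)]
    simp [coeff_X, coeff_one]

/-- The reversal `∏ (1 - a X)` of the monic polynomial with a given multiset of roots. -/
noncomputable def reversedProd (s : Multiset ℝ) : PowerSeries ℝ :=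
  (s.map fun a => 1 - PowerSeries.C a * PowerSeries.X).prod

theorem coe_reverse_prod_X_sub_C (s : Multiset ℝ) :
    ((s.map fun a => X - C a).prod.reverse : PowerSeries ℝ) = reversedProd s := by
  induction s using Multiset.induction_on with
  | empty =>
    have : reverse (1 : ℝ[X]) = 1 := reverse_C 1
    simp [reversedProd, this]
  | cons a s ih =>
    rw [Multiset.map_cons, Multiset.prod_cons, reverse_mul_of_domain, coe_mul, ih,
      reverse_X_sub_C]
    simp [reversedProd]

/-- The generating function of the power sums of a multiset. -/
noncomputable def powerSumSeries (s : Multiset ℝ) : PowerSeries ℝ :=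
  PowerSeries.mk fun k => (s.map (· ^ k)).sum

theorem X_mul_derivative_reversedProd (s : Multiset ℝ) :
    PowerSeries.X * PowerSeries.derivative ℝ (reversedProd s) =
      ((Multiset.card s : PowerSeries ℝ) - powerSumSeries s) * reversedProd s := by
  induction s using Multiset.induction_on with
  | empty =>
    have : powerSumSeries 0 = 0 := by ext; simp [powerSumSeries]
    simp [this, reversedProd]
  | cons a s ih =>
    have hgeom : (PowerSeries.mk fun k => a ^ k) * (1 - PowerSeries.C a * PowerSeries.X) = 1 := by
      have := congrArg (PowerSeries.rescale a) (PowerSeries.mk_one_mul_one_sub_eq_one ℝ)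
      simpa [PowerSeries.rescale_mk] using this
    have hsum : powerSumSeries (a ::ₘ s) = PowerSeries.mk (fun k => a ^ k) + powerSumSeries s := by
      ext; simp [powerSumSeries]
    have hprod : reversedProd (a ::ₘ s) =
        (1 - PowerSeries.C a * PowerSeries.X) * reversedProd s := by
      simp [reversedProd]
    rw [hsum, hprod, Multiset.card_cons, Derivation.leibniz]
    simp only [map_sub, Derivation.leibniz, smul_eq_mul, PowerSeries.derivative_C,
      PowerSeries.derivative_X, PowerSeries.derivative_one]
    push_cast
    linear_combination (1 - PowerSeries.C a * PowerSeries.X) * ih + reversedProd s * hgeom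

theorem reversedProd_roots_signedTouchard_succ (n : ℕ) :
    reversedProd (signedTouchard (n + 1)).roots = reversedProd (signedTouchard n).roots *
      (1 - PowerSeries.X * powerSumSeries (signedTouchard n).roots) := by
  have hrev (n : ℕ) : reversedProd (signedTouchard n).roots = (signedTouchard n).reverse := by
    rw [← coe_reverse_prod_X_sub_C, ←
      (signedTouchard_splits n).eq_prod_roots_of_monic (signedTouchard_monic n)]
  have h := X_mul_derivative_reversedProd (signedTouchard n).roots
  have hmain : ((signedTouchard (n + 1)).reverse : PowerSeries ℝ) =
      ((signedTouchard n).reverse : PowerSeries ℝ) -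
        PowerSeries.X * ((n : PowerSeries ℝ) * ((signedTouchard n).reverse : PowerSeries ℝ) -
          PowerSeries.X *
            PowerSeries.derivative ℝ ((signedTouchard n).reverse : PowerSeries ℝ)) := by
    ext k
    have hn : (n : PowerSeries ℝ) = PowerSeries.C (n : ℝ) := by simp
    cases k with
    | zero => simp [signedTouchard_monic]
    | succ k =>
      rw [map_sub, PowerSeries.coeff_succ_X_mul, map_sub, hn, PowerSeries.coeff_C_mul]
      have hX : PowerSeries.coeff k (PowerSeries.X *
          PowerSeries.derivative ℝ ((signedTouchard n).reverse : PowerSeries ℝ)) =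
          k * (signedTouchard n).reverse.coeff k := by
        cases k with
        | zero => simp
        | succ k =>
          rw [PowerSeries.coeff_succ_X_mul, PowerSeries.coeff_derivative, coeff_coe]
          push_cast; ring
      rw [hX]
      simp only [coeff_coe, coeff_reverse, signedTouchard_natDegree]
      rcases lt_trichotomy k n with hk | rfl | hk
      · rw [revAt_le (by omega), revAt_le (by omega), revAt_le (by omega)]
        obtain ⟨m, rfl⟩ : ∃ m, n = k + 1 + m := ⟨n - (k + 1), by omega⟩
        rw [show k + 1 + m + 1 - (k + 1) = m + 1 by omega, show k + 1 + m - (k + 1) = m by omega,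
          show k + 1 + m - k = m + 1 by omega, signedTouchard_succ, coeff_X_mul, coeff_sub,
          coeff_derivative]
        push_cast; ring
      · rw [revAt_le le_rfl, revAt_eq_self_of_lt (by omega), revAt_le le_rfl,
          coeff_eq_zero_of_natDegree_lt (p := signedTouchard k)
            (by rw [signedTouchard_natDegree]; omega)]
        simp [signedTouchard_succ]
      · rw [revAt_eq_self_of_lt (by omega), revAt_eq_self_of_lt (by omega),
          revAt_eq_self_of_lt (by omega),
          coeff_eq_zero_of_natDegree_lt (by rw [signedTouchard_natDegree]; omega),
          coeff_eq_zero_of_natDegree_lt (by rw [signedTouchard_natDegree]; omega),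
          coeff_eq_zero_of_natDegree_lt (by rw [signedTouchard_natDegree]; omega)]
        simp
  rw [card_roots_signedTouchard] at h
  rw [hrev] at h ⊢
  rw [hrev, hmain]
  linear_combination PowerSeries.X * h

/-- The divided Abel polynomials `x (x + k) ^ (k - 1) / k!`. -/
noncomputable def dividedAbel : ℕ → ℝ → ℝ
  | 0, _ => 1
  | k + 1, x => x * (x + (k + 1)) ^ k / (k + 1).factorial

theorem hasDerivAt_dividedAbel_succ (k : ℕ) (x : ℝ) :
    HasDerivAt (dividedAbel (k + 1)) (dividedAbel k (x + 1)) x := by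
  have h : HasDerivAt (dividedAbel (k + 1))
      ((1 * (x + (k + 1)) ^ k + x * (k * (x + (k + 1)) ^ (k - 1) * 1)) / (k + 1).factorial) x :=
    ((hasDerivAt_id x).mul (((hasDerivAt_id x).add_const (k + 1 : ℝ)).pow k)).div_const _
  refine h.congr_deriv ?_
  cases k with
  | zero => simp [dividedAbel]
  | succ k =>
    rw [dividedAbel, Nat.factorial_succ (k + 1), add_tsub_cancel_right]
    have := Nat.factorial_ne_zero (k + 1)
    push_cast
    field_simp
    ring

theorem dividedAbel_succ_zero (k : ℕ) : dividedAbel (k + 1) 0 = 0 := by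
  simp [dividedAbel]

/-- Abel's identity. -/
theorem sum_antidiagonal_dividedAbel (m : ℕ) (x y : ℝ) :
    ∑ ij ∈ Finset.HasAntidiagonal.antidiagonal m, dividedAbel ij.1 x * dividedAbel ij.2 y =
      dividedAbel m (x + y) := by
  induction m generalizing x with
  | zero => simp [dividedAbel]
  | succ m ih =>
    set f : ℝ → ℝ := fun x => ∑ ij ∈ Finset.HasAntidiagonal.antidiagonal (m + 1),
      dividedAbel ij.1 x * dividedAbel ij.2 y - dividedAbel (m + 1) (x + y) with hf
    have hder (x : ℝ) : HasDerivAt f 0 x := by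
      simp only [hf, Finset.Nat.sum_antidiagonal_succ]
      have h0 : HasDerivAt (fun x => dividedAbel 0 x * dividedAbel (m + 1) y) 0 x := by
        simpa only [dividedAbel] using hasDerivAt_const x _
      have h1 : HasDerivAt (fun x => ∑ ij ∈ Finset.HasAntidiagonal.antidiagonal m,
          dividedAbel (ij.1 + 1) x * dividedAbel ij.2 y) (dividedAbel m (x + 1 + y)) x := by
        rw [← ih (x + 1)]
        exact HasDerivAt.fun_sum fun ij _ => (hasDerivAt_dividedAbel_succ ij.1 x).mul_const _
      have h2 := (hasDerivAt_dividedAbel_succ m (x + y)).comp_add_const x y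
      refine ((h0.add h1).sub h2).congr_deriv ?_
      rw [add_right_comm]
      ring
    have hconst := is_const_of_deriv_eq_zero (fun x => (hder x).differentiableAt)
      (fun x => (hder x).deriv) x 0
    have hzero : f 0 = 0 := by
      simp only [hf, Finset.Nat.sum_antidiagonal_succ, dividedAbel_succ_zero]
      simp [dividedAbel]
    exact sub_eq_zero.1 (hconst.trans hzero)

theorem dividedAbel_nonneg (k : ℕ) {x : ℝ} (hx : 0 ≤ x) : 0 ≤ dividedAbel k x := by
  cases k <;> simp only [dividedAbel] <;> positivity

theorem succ_mul_dividedAbel_one (m : ℕ) :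
    ∑ ij ∈ Finset.HasAntidiagonal.antidiagonal m, dividedAbel ij.1 1 * ((ij.2 + 1) * dividedAbel ij.2 1) =
      (m + 1) * dividedAbel (m + 1) 1 := by
  set T := ∑ ij ∈ Finset.HasAntidiagonal.antidiagonal m, dividedAbel ij.1 1 * ((ij.2 + 1) * dividedAbel ij.2 1)
  have hswap : T = ∑ ij ∈ Finset.HasAntidiagonal.antidiagonal m,
      dividedAbel ij.1 1 * ((ij.1 + 1) * dividedAbel ij.2 1) := by
    rw [← Finset.Nat.sum_antidiagonal_swap]
    exact Finset.sum_congr rfl fun ij _ => by simp only [Prod.fst_swap, Prod.snd_swap]; ring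
  have hadd : T + T = (m + 2) * dividedAbel m (1 + 1) := by
    nth_rewrite 2 [hswap]
    rw [← sum_antidiagonal_dividedAbel, Finset.mul_sum, ← Finset.sum_add_distrib]
    refine Finset.sum_congr rfl fun ij hij => ?_
    have : (ij.1 : ℝ) + ij.2 = m := by exact_mod_cast Finset.HasAntidiagonal.mem_antidiagonal.1 hij
    rw [← this]
    ring
  have hval : (m + 2) * dividedAbel m (1 + 1) = 2 * ((m + 1) * dividedAbel (m + 1) 1) := by
    cases m with
    | zero => simp [dividedAbel]
    | succ m =>
      rw [dividedAbel, dividedAbel, Nat.factorial_succ (m + 1)]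
      have := Nat.factorial_ne_zero (m + 1)
      push_cast
      field_simp
      ring
  linarith

theorem Nat.descFactorial_mono_left {m n : ℕ} (h : m ≤ n) (k : ℕ) :
    m.descFactorial k ≤ n.descFactorial k := by
  induction k with
  | zero => simp
  | succ k ih =>
    rw [Nat.descFactorial_succ, Nat.descFactorial_succ]
    exact Nat.mul_le_mul (Nat.sub_le_sub_right h k) ih

theorem Nat.descFactorial_add_le_mul (n i j : ℕ) :
    n.descFactorial (i + j) ≤ n.descFactorial i * n.descFactorial j := by
  rw [← Nat.descFactorial_mul_descFactorial (Nat.le_add_right i j), Nat.add_sub_cancel_left,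
    mul_comm]
  exact Nat.mul_le_mul_left _ (Nat.descFactorial_mono_left (Nat.sub_le n i) j)

theorem Nat.succ_descFactorial_eq_add (n k : ℕ) :
    (n + 1).descFactorial (k + 1) = n.descFactorial (k + 1) + (k + 1) * n.descFactorial k := by
  rw [Nat.succ_descFactorial_succ, Nat.descFactorial_succ, ← add_mul]
  rcases le_or_gt k n with h | h
  · congr 1; omega
  · simp [Nat.descFactorial_eq_zero_iff_lt.2 h]

/-- The power series `(1 - X B)⁻¹`, `B` the generating function of the power sums of the roots of
`signedTouchard n`; it is the quotient of two consecutive reversed Touchard polynomials. -/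
noncomputable def touchardRatio (n : ℕ) : PowerSeries ℝ :=
  (1 - PowerSeries.X * powerSumSeries (signedTouchard n).roots)⁻¹

theorem touchardRatio_mul (n : ℕ) :
    touchardRatio n * (1 - PowerSeries.X * powerSumSeries (signedTouchard n).roots) = 1 :=
  PowerSeries.inv_mul_cancel _ (by simp)

theorem coeff_zero_touchardRatio (n : ℕ) : PowerSeries.coeff 0 (touchardRatio n) = 1 := by
  simp [touchardRatio]

theorem powerSumSeries_succ (n : ℕ) :
    powerSumSeries (signedTouchard (n + 1)).roots - powerSumSeries (signedTouchard n).roots - 1 =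
      touchardRatio n * (PowerSeries.X * PowerSeries.derivative ℝ
        (PowerSeries.X * powerSumSeries (signedTouchard n).roots)) := by
  set B := powerSumSeries (signedTouchard n).roots with hB
  set B' := powerSumSeries (signedTouchard (n + 1)).roots with hB'
  set F := reversedProd (signedTouchard n).roots with hF
  have h := X_mul_derivative_reversedProd (signedTouchard n).roots
  have h' := X_mul_derivative_reversedProd (signedTouchard (n + 1)).roots
  rw [reversedProd_roots_signedTouchard_succ, Derivation.leibniz, card_roots_signedTouchard] at h'
  rw [card_roots_signedTouchard] at h
  simp only [← hB, ← hB', ← hF, map_sub, smul_eq_mul, PowerSeries.derivative_one] at h h'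
  have hF0 : F ≠ 0 := by
    intro h0
    have : PowerSeries.constantCoeff F = 1 := by
      simp [hF, reversedProd, map_multiset_prod]
    simp [h0] at this
  have hu := touchardRatio_mul n
  rw [← hB] at hu
  have key : F * (PowerSeries.X * PowerSeries.derivative ℝ (PowerSeries.X * B)) =
      F * ((B' - B - 1) * (1 - PowerSeries.X * B)) := by
    push_cast at h'
    linear_combination (1 - PowerSeries.X * B) * h - h'
  rw [mul_left_cancel₀ hF0 key]
  linear_combination -(B' - B - 1) * hu

theorem touchardRatio_succ (n : ℕ) :
    touchardRatio (n + 1) = touchardRatio n + PowerSeries.X * (touchardRatio (n + 1) *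
      PowerSeries.derivative ℝ (PowerSeries.X * touchardRatio n)) := by
  have h := powerSumSeries_succ n
  have hu := touchardRatio_mul n
  have hu' := touchardRatio_mul (n + 1)
  set B := powerSumSeries (signedTouchard n).roots
  set B' := powerSumSeries (signedTouchard (n + 1)).roots
  set E := touchardRatio n
  set E' := touchardRatio (n + 1)
  have hd := congrArg (PowerSeries.derivative ℝ) hu
  rw [Derivation.leibniz] at hd
  rw [Derivation.leibniz]
  simp only [map_sub, smul_eq_mul, PowerSeries.derivative_one, PowerSeries.derivative_X] at hd ⊢
  have hE : PowerSeries.derivative ℝ E = E ^ 2 * PowerSeries.derivative ℝ (PowerSeries.X * B) := by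
    linear_combination E * hd - PowerSeries.derivative ℝ E * hu
  rw [hE]
  linear_combination PowerSeries.X * E' * E * h - E' * hu + E * hu'

theorem coeff_touchardRatio_succ (n m : ℕ) :
    PowerSeries.coeff (m + 1) (touchardRatio (n + 1)) =
      PowerSeries.coeff (m + 1) (touchardRatio n) +
        ∑ ij ∈ Finset.HasAntidiagonal.antidiagonal m, PowerSeries.coeff ij.1 (touchardRatio (n + 1)) *
          ((ij.2 + 1) * PowerSeries.coeff ij.2 (touchardRatio n)) := by
  conv_lhs => rw [touchardRatio_succ]
  rw [map_add, PowerSeries.coeff_succ_X_mul, PowerSeries.coeff_mul]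
  congr 1
  refine Finset.sum_congr rfl fun ij _ => ?_
  rw [PowerSeries.coeff_derivative, PowerSeries.coeff_succ_X_mul]
  ring

theorem dividedAbel_mul_descFactorial_le_coeff (n k : ℕ) :
    dividedAbel k 1 * n.descFactorial k ≤ PowerSeries.coeff k (touchardRatio n) := by
  induction n generalizing k with
  | zero =>
    cases k with
    | zero => simp [dividedAbel, coeff_zero_touchardRatio]
    | succ k =>
      have : powerSumSeries (signedTouchard 0).roots = 0 := by
        ext; simp [powerSumSeries, signedTouchard_zero]
      simp [touchardRatio, this, PowerSeries.coeff_one]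
  | succ n ih =>
    induction k using Nat.strong_induction_on with
    | _ k ihk =>
      cases k with
      | zero => simp [dividedAbel, coeff_zero_touchardRatio]
      | succ m =>
        rw [coeff_touchardRatio_succ, Nat.succ_descFactorial_eq_add]
        push_cast
        rw [mul_add]
        refine add_le_add (ih (m + 1)) ?_
        rw [show dividedAbel (m + 1) 1 * ((m + 1) * (n.descFactorial m : ℝ)) =
          (m + 1) * dividedAbel (m + 1) 1 * n.descFactorial m by ring,
          ← succ_mul_dividedAbel_one, Finset.sum_mul]
        refine Finset.sum_le_sum fun ij hij => ?_
        obtain ⟨i, j⟩ := ij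
        have hij' : i + j = m := Finset.HasAntidiagonal.mem_antidiagonal.1 hij
        have hi := dividedAbel_nonneg i zero_le_one
        have hj := dividedAbel_nonneg j zero_le_one
        have hdesc : (n.descFactorial m : ℝ) ≤
            (n + 1).descFactorial i * n.descFactorial j := by
          rw [← hij']
          exact_mod_cast (Nat.descFactorial_add_le_mul n i j).trans
            (Nat.mul_le_mul_right _ (Nat.descFactorial_mono_left n.le_succ i))
        calc dividedAbel i 1 * ((j + 1) * dividedAbel j 1) * (n.descFactorial m : ℝ)
            ≤ dividedAbel i 1 * ((j + 1) * dividedAbel j 1) *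
              ((n + 1).descFactorial i * n.descFactorial j) := by gcongr
          _ = (dividedAbel i 1 * (n + 1).descFactorial i) *
              ((j + 1) * (dividedAbel j 1 * n.descFactorial j)) := by ring
          _ ≤ _ := by
            gcongr
            · exact (mul_nonneg hi (Nat.cast_nonneg _)).trans (ihk i (by omega))
            · exact ihk i (by omega)
            · exact ih j

theorem sum_pow_roots_signedTouchard_succ_ge (n m : ℕ) :
    ((signedTouchard n).roots.map (· ^ (m + 1))).sum +
        PowerSeries.coeff (m + 1) (touchardRatio n) ≤
      ((signedTouchard (n + 1)).roots.map (· ^ (m + 1))).sum := by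
  have h := congrArg (PowerSeries.coeff (m + 1)) (powerSumSeries_succ n)
  have hu := congrArg (PowerSeries.coeff (m + 1)) (touchardRatio_mul n)
  rw [mul_sub, mul_one, mul_left_comm, map_sub, PowerSeries.coeff_succ_X_mul,
    PowerSeries.coeff_mul, PowerSeries.coeff_one, if_neg m.succ_ne_zero] at hu
  rw [mul_left_comm, map_sub, map_sub, PowerSeries.coeff_succ_X_mul,
    PowerSeries.coeff_mul, PowerSeries.coeff_one, if_neg m.succ_ne_zero] at h
  simp only [powerSumSeries, PowerSeries.coeff_mk, PowerSeries.coeff_derivative,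
    PowerSeries.coeff_succ_X_mul] at h hu
  have hle : ∑ ij ∈ Finset.HasAntidiagonal.antidiagonal m, PowerSeries.coeff ij.1 (touchardRatio n) *
        ((signedTouchard n).roots.map (· ^ ij.2)).sum ≤
      ∑ ij ∈ Finset.HasAntidiagonal.antidiagonal m, PowerSeries.coeff ij.1 (touchardRatio n) *
        (((signedTouchard n).roots.map (· ^ ij.2)).sum * (ij.2 + 1)) := by
    refine Finset.sum_le_sum fun ij _ => mul_le_mul_of_nonneg_left ?_ ?_
    · refine le_mul_of_one_le_right (Multiset.sum_nonneg fun a ha => ?_) (by simp)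
      obtain ⟨z, hz, rfl⟩ := Multiset.mem_map.1 ha
      exact pow_nonneg (nonneg_of_mem_roots_signedTouchard z hz) _
    · exact (mul_nonneg (dividedAbel_nonneg _ zero_le_one) (Nat.cast_nonneg _)).trans
        (dividedAbel_mul_descFactorial_le_coeff n ij.1)
  linarith

theorem dividedAbel_mul_descFactorial_le_sum_pow_roots (n : ℕ) {k : ℕ} (hk : k ≠ 0) :
    dividedAbel k 1 / (k + 1) * n.descFactorial (k + 1) ≤
      ((signedTouchard n).roots.map (· ^ k)).sum := by
  obtain ⟨m, rfl⟩ := Nat.exists_eq_succ_of_ne_zero hk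
  induction n with
  | zero => simp [signedTouchard_zero]
  | succ n ih =>
    refine le_trans (le_of_eq ?_) ((add_le_add ih
      (dividedAbel_mul_descFactorial_le_coeff n (m + 1))).trans
        (sum_pow_roots_signedTouchard_succ_ge n m))
    rw [Nat.succ_descFactorial_eq_add n (m.succ)]
    push_cast
    field_simp

theorem exp_mul_factorial_succ_le (k : ℕ) :
    Real.exp k * (k + 1).factorial ≤ (k + 1 : ℝ) ^ (k + 2) := by
  induction k with
  | zero => simp
  | succ k ih =>
    have hk : (0 : ℝ) < k + 1 + 1 := by positivity
    have h1 : (k + 1 : ℝ) ^ (k + 2) * Real.exp 1 ≤ (k + 1 + 1) ^ (k + 2) := by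
      have h2 : (k + 1 : ℝ) / (k + 1 + 1) ≤ Real.exp (-(1 / (k + 1 + 1))) := by
        refine le_trans (le_of_eq ?_) (Real.add_one_le_exp _)
        field_simp
        ring
      have h3 := pow_le_pow_left₀ (by positivity) h2 (k + 2)
      rw [← Real.exp_nat_mul, div_pow, div_le_iff₀ (by positivity)] at h3
      have h4 : ((k + 2 : ℕ) : ℝ) * -(1 / (k + 1 + 1)) = -1 := by
        push_cast; field_simp; ring
      rw [h4] at h3
      calc (k + 1 : ℝ) ^ (k + 2) * Real.exp 1
          ≤ Real.exp (-1) * (k + 1 + 1) ^ (k + 2) * Real.exp 1 := by gcongr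
        _ = (Real.exp (-1) * Real.exp 1) * (k + 1 + 1) ^ (k + 2) := by ring
        _ = (k + 1 + 1) ^ (k + 2) := by rw [← Real.exp_add]; simp
    rw [Nat.factorial_succ]
    push_cast
    rw [Real.exp_add]
    calc Real.exp k * Real.exp 1 * ((k + 1 + 1) * (k + 1).factorial)
        = (Real.exp k * (k + 1).factorial) * Real.exp 1 * (k + 1 + 1) := by ring
      _ ≤ (k + 1 : ℝ) ^ (k + 2) * Real.exp 1 * (k + 1 + 1) := by gcongr
      _ ≤ (k + 1 + 1) ^ (k + 2) * (k + 1 + 1) := by gcongr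
      _ = _ := by ring

theorem exists_pow_lt_dividedAbel {ε : ℝ} (hε0 : 0 < ε) (hε1 : ε < 1) :
    ∃ k ≠ 0, ((1 - ε) * Real.exp 1) ^ k < dividedAbel k 1 / (k + 1) := by
  have hlim := (tendsto_pow_const_mul_const_pow_of_abs_lt_one 3
    (r := 1 - ε) (by rw [abs_lt]; constructor <;> linarith)).comp (Filter.tendsto_add_atTop_nat 1)
  have hpos : 0 < 1 - ε := by linarith
  obtain ⟨k, hk, hk0⟩ := ((hlim.eventually_lt_const hpos).and
    (Filter.eventually_ge_atTop 1)).exists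
  obtain ⟨m, rfl⟩ := Nat.exists_eq_add_of_le' hk0
  refine ⟨m + 1, m.succ_ne_zero, ?_⟩
  have hk1 : (m + 1 + 1 : ℝ) ^ 3 * (1 - ε) ^ (m + 1) < 1 := by
    simp only [Function.comp] at hk
    rw [pow_succ (1 - ε) (m + 1), ← mul_assoc] at hk
    push_cast at hk
    exact (mul_lt_iff_lt_one_left hpos).1 hk
  have hfac := exp_mul_factorial_succ_le (m + 1)
  rw [dividedAbel, mul_pow, Real.exp_one_pow, div_div, lt_div_iff₀ (by positivity)]
  have hfac' : ((m + 1 + 1).factorial : ℝ) = (m + 1 + 1) * (m + 1).factorial := by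
    rw [Nat.factorial_succ]; push_cast; ring
  rw [hfac'] at hfac
  push_cast at hfac ⊢
  calc (1 - ε) ^ (m + 1) * Real.exp (m + 1) * ((m + 1).factorial * (m + 1 + 1))
      = (1 - ε) ^ (m + 1) * (Real.exp (m + 1) * ((m + 1 + 1) * (m + 1).factorial)) := by ring
    _ ≤ (1 - ε) ^ (m + 1) * (m + 1 + 1) ^ (m + 1 + 2) := by gcongr
    _ = ((m + 1 + 1) ^ 3 * (1 - ε) ^ (m + 1)) * (m + 1 + 1) ^ m := by ring
    _ < 1 * (m + 1 + 1) ^ m := by gcongr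
    _ = _ := by ring

theorem eventually_exists_mem_roots_signedTouchard_gt {ε : ℝ} (hε0 : 0 < ε) (hε1 : ε < 1) :
    ∀ᶠ n : ℕ in Filter.atTop, ∃ z ∈ (signedTouchard n).roots, n * ((1 - ε) * Real.exp 1) < z := by
  obtain ⟨k, hk0, hk⟩ := exists_pow_lt_dividedAbel hε0 hε1
  set a := (1 - ε) * Real.exp 1
  set b := dividedAbel k 1 / (k + 1)
  have hlim : Filter.Tendsto (fun n : ℕ => b * ((n.descFactorial (k + 1) : ℝ) / n ^ (k + 1)))
      Filter.atTop (nhds (b * 1)) :=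
    (((Asymptotics.isEquivalent_iff_tendsto_one ((Filter.eventually_gt_atTop 0).mono
      fun n hn => by positivity)).1 (isEquivalent_descFactorial (k + 1)))).const_mul b
  rw [mul_one] at hlim
  filter_upwards [hlim.eventually_const_lt hk, Filter.eventually_gt_atTop 0] with n hn hn0
  by_contra! hall
  have hn0' : (0 : ℝ) < n := by positivity
  have h1 := Multiset.sum_le_card_nsmul ((signedTouchard n).roots.map (· ^ k)) ((n * a) ^ k)
    fun x hx => by
      obtain ⟨z, hz, rfl⟩ := Multiset.mem_map.1 hx
      exact pow_le_pow_left₀ (nonneg_of_mem_roots_signedTouchard z hz) (hall z hz) k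
  rw [Multiset.card_map, card_roots_signedTouchard, nsmul_eq_mul] at h1
  have h2 := (dividedAbel_mul_descFactorial_le_sum_pow_roots n hk0).trans h1
  rw [← mul_div_assoc, lt_div_iff₀ (by positivity)] at hn
  have h3 : (n : ℝ) * (n * a) ^ k = a ^ k * n ^ (k + 1) := by
    rw [mul_pow, pow_succ]
    ring
  linarith

/-- For every `0 < ε < 1` there exists `N` such that for all `n ≥ N`, the polynomial
`Σ_{i=1}^{n} S(n, i) x^i` (the σ-polynomial of the edgeless graph on `n` vertices) has a
real root in the open interval `(−n·e, −n·(1−ε)·e)`. -/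
theorem stirling_sigma_root_near_neg_n_e (ε : ℝ) (hε0 : 0 < ε) (hε1 : ε < 1) :
    ∃ N : ℕ, ∀ n : ℕ, N ≤ n →
      ∃ r : ℝ, (∑ i ∈ Finset.Icc 1 n, (stirling2 n i : ℝ) * r ^ i) = 0 ∧
        -(n : ℝ) * Real.exp 1 < r ∧ r < -(n : ℝ) * (1 - ε) * Real.exp 1 := by
  obtain ⟨N, hN⟩ := Filter.eventually_atTop.1
    ((eventually_exists_mem_roots_signedTouchard_gt hε0 hε1).and (Filter.eventually_gt_atTop 0))
  refine ⟨N, fun n hn => ?_⟩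
  obtain ⟨⟨z, hz, hlt⟩, hn0⟩ := hN n hn
  refine ⟨-z, ?_, ?_, ?_⟩
  · rw [sum_stirling2_mul_neg_pow hn0.ne', mem_roots_signedTouchard.1 hz, mul_zero]
  · linarith [lt_of_mem_roots_signedTouchard hn0.ne' hz]
  · linarith
end
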